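/- Let φ : ℝ² → ℝ be a C² function and λ > 0 a real number such that Δφ = −λφ on the unit square D = [0,1]², φ = 0 on the boundary ∂D, and φ is not identically zero. Assume φ has no interior singular point, i.e., for every p in the open square (0,1)², φ(p) = 0 implies ∇φ(p) ≠ 0. Then the number N(φ) of nodal domains of φ satisfies N(φ) ≤ λ/(2π²) + 2√λ/π + 1. -/

import Mathlib

open Real

/-- The Euclidean Laplacian of a function `φ : ℝ × ℝ → ℝ`. -/
noncomputable def laplacian2 (φ : ℝ × ℝ → ℝ) (p : ℝ × ℝ) : ℝ :=
  deriv (fun x => deriv (fun x' => φ (x', p.2)) x) p.1 +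
  deriv (fun y => deriv (fun y' => φ (p.1, y')) y) p.2

theorem integral_mul_sin_mul_cos_pow_eq_zero {r : ℝ → ℝ} (hr : Continuous r)
    (h : ∀ m : ℕ, ∫ x in (0 : ℝ)..1, r x * sin (m * π * x) = 0) (j m : ℕ) :
    ∫ x in (0 : ℝ)..1, r x * sin (m * π * x) * cos (π * x) ^ j = 0 := by
  induction j generalizing m with
  | zero => simpa using h m
  | succ j ih =>
    rcases m with _ | m
    · simp
    have hi : ∀ n : ℕ, IntervalIntegrable
        (fun x => r x * sin (n * π * x) * cos (π * x) ^ j) MeasureTheory.volume 0 1 :=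
      fun n => Continuous.intervalIntegrable (by fun_prop) _ _
    have key : ∀ x, r x * sin ((m + 1 : ℕ) * π * x) * cos (π * x) ^ (j + 1) =
        (1 / 2) * (r x * sin ((m + 2 : ℕ) * π * x) * cos (π * x) ^ j +
          r x * sin (m * π * x) * cos (π * x) ^ j) := by
      intro x
      have h1 : ((m + 2 : ℕ) : ℝ) * π * x = (m + 1 : ℕ) * π * x + π * x := by push_cast; ring
      have h2 : (m : ℝ) * π * x = (m + 1 : ℕ) * π * x - π * x := by push_cast; ring
      rw [h1, h2, sin_add, sin_sub]; ring
    simp_rw [key]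
    rw [intervalIntegral.integral_const_mul, intervalIntegral.integral_add (hi _) (hi _), ih, ih]
    simp

theorem integral_mul_sin_mul_polynomial_eq_zero {r : ℝ → ℝ} (hr : Continuous r)
    (h : ∀ m : ℕ, ∫ x in (0 : ℝ)..1, r x * sin (m * π * x) = 0) (q : Polynomial ℝ) :
    ∫ x in (0 : ℝ)..1, r x * sin (π * x) * q.eval (cos (π * x)) = 0 := by
  simp_rw [Polynomial.eval_eq_sum_range, Finset.mul_sum]
  rw [intervalIntegral.integral_finsetSum
    (fun i _ => Continuous.intervalIntegrable (by fun_prop) _ _)]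
  refine Finset.sum_eq_zero fun i _ => ?_
  have := integral_mul_sin_mul_cos_pow_eq_zero hr h i 1
  simp only [Nat.cast_one, one_mul] at this
  simp_rw [mul_left_comm _ (q.coeff i)]
  rw [intervalIntegral.integral_const_mul, this, mul_zero]

/-- A continuous function all of whose sine coefficients on `[0, 1]` vanish is zero there. -/
theorem eq_zero_of_sine_coeff_eq_zero {r : ℝ → ℝ} (hr : Continuous r)
    (h : ∀ m : ℕ, ∫ x in (0 : ℝ)..1, r x * sin (m * π * x) = 0) :
    ∀ x ∈ Set.Icc (0 : ℝ) 1, r x = 0 := by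
  have hnn : ∀ x ∈ Set.Icc (0 : ℝ) 1, 0 ≤ sin (π * x) := fun x hx =>
    sin_nonneg_of_nonneg_of_le_pi (by have := pi_pos; have := hx.1; positivity)
      (by nlinarith [pi_pos, hx.2])
  set I : ℝ := ∫ x in (0 : ℝ)..1, r x ^ 2 * sin (π * x) with hI
  set B : ℝ := ∫ x in (0 : ℝ)..1, |r x * sin (π * x)| with hB
  have hB0 : 0 ≤ B := intervalIntegral.integral_nonneg zero_le_one fun x _ => abs_nonneg _
  have hle : ∀ ε > 0, I ≤ ε * B := by
    intro ε hε
    obtain ⟨q, hq⟩ := exists_polynomial_near_of_continuousOn (-1) 1 (fun t => r (arccos t / π))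
      (by fun_prop) ε hε
    have h1 : I = ∫ x in (0 : ℝ)..1, (r x * sin (π * x)) * (r x - q.eval (cos (π * x))) := by
      have := integral_mul_sin_mul_polynomial_eq_zero hr h q
      have h2 : ∀ x, r x * sin (π * x) * (r x - q.eval (cos (π * x))) =
          r x ^ 2 * sin (π * x) - r x * sin (π * x) * q.eval (cos (π * x)) := fun x => by ring
      simp_rw [h2]
      rw [intervalIntegral.integral_sub (Continuous.intervalIntegrable (by fun_prop) _ _)
          (Continuous.intervalIntegrable (by fun_prop) _ _), this, sub_zero]
    rw [h1, hB, ← intervalIntegral.integral_const_mul]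
    refine intervalIntegral.integral_mono_on zero_le_one
      (Continuous.intervalIntegrable (by fun_prop) _ _)
      (Continuous.intervalIntegrable (by fun_prop) _ _) fun x hx => ?_
    have h2 := hq (cos (π * x)) ⟨neg_one_le_cos _, cos_le_one _⟩
    rw [arccos_cos (by have := pi_pos; have := hx.1; positivity) (by nlinarith [pi_pos, hx.2]),
      mul_div_cancel_left₀ _ pi_ne_zero, abs_sub_comm] at h2
    calc _ ≤ |r x * sin (π * x) * (r x - q.eval (cos (π * x)))| := le_abs_self _
      _ = |r x - q.eval (cos (π * x))| * |r x * sin (π * x)| := by rw [abs_mul, mul_comm]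
      _ ≤ _ := mul_le_mul_of_nonneg_right h2.le (abs_nonneg _)
  have hI0 : I ≤ 0 := by
    refine le_of_forall_pos_le_add fun ε hε => ?_
    have := hle (ε / (B + 1)) (by positivity)
    have h3 : ε / (B + 1) * B ≤ ε := by
      rw [div_mul_eq_mul_div, div_le_iff₀ (by positivity)]; nlinarith
    linarith
  have hz : ∀ x ∈ Set.Ioo (0 : ℝ) 1, r x = 0 := by
    by_contra! hc
    obtain ⟨x, hx, hx0⟩ := hc
    have hpos : 0 < I := by
      refine intervalIntegral.integral_pos zero_lt_one (by fun_prop)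
        (fun y hy => mul_nonneg (sq_nonneg _) (hnn y ⟨hy.1.le, hy.2⟩)) ⟨x, ⟨hx.1.le, hx.2.le⟩, ?_⟩
      have : 0 < sin (π * x) := sin_pos_of_pos_of_lt_pi (mul_pos pi_pos hx.1)
        (by nlinarith [pi_pos, hx.2])
      positivity
    linarith
  have hcl : closure (Set.Ioo (0 : ℝ) 1) ⊆ {x | r x = 0} :=
    closure_minimal hz (isClosed_eq hr continuous_const)
  rw [closure_Ioo zero_ne_one] at hcl
  exact hcl

theorem integral_sin_mul_sin (m n : ℕ) (hm : m ≠ 0) :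
    ∫ x in (0 : ℝ)..1, sin (m * π * x) * sin (n * π * x) = if m = n then 1 / 2 else 0 := by
  have hc : ∀ k : ℤ, k ≠ 0 → ∫ x in (0 : ℝ)..1, cos (k * π * x) = 0 := by
    intro k hk
    have hk' : (k : ℝ) * π ≠ 0 := mul_ne_zero (by exact_mod_cast hk) pi_ne_zero
    rw [intervalIntegral.integral_comp_mul_left (fun x => cos x) hk']
    simp
  have key : ∀ x, sin (m * π * x) * sin (n * π * x) =
      (1 / 2) * (cos (((m - n : ℤ) : ℝ) * π * x) - cos (((m + n : ℤ) : ℝ) * π * x)) := by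
    intro x
    have h1 : ((m - n : ℤ) : ℝ) * π * x = m * π * x - n * π * x := by push_cast; ring
    have h2 : ((m + n : ℤ) : ℝ) * π * x = m * π * x + n * π * x := by push_cast; ring
    rw [h1, h2, cos_add, cos_sub]; ring
  simp_rw [key]
  rw [intervalIntegral.integral_const_mul, intervalIntegral.integral_sub
    (Continuous.intervalIntegrable (by fun_prop) _ _)
    (Continuous.intervalIntegrable (by fun_prop) _ _), hc (m + n) (by omega)]
  split_ifs with hmn
  · subst hmn; simp
  · rw [hc _ (by omega)]; simp

/-- A continuous function with finitely many nonzero sine coefficients on `[0, 1]` is `sin (π x)`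
times a polynomial in `cos (π x)`. -/
theorem exists_polynomial_of_sine_coeff_eq_zero {f : ℝ → ℝ} (hf : Continuous f) (K : ℕ)
    (h : ∀ m : ℕ, K ≤ m → ∫ x in (0 : ℝ)..1, f x * sin (m * π * x) = 0) :
    ∃ p : Polynomial ℝ, p.natDegree ≤ K - 1 ∧
      ∀ x ∈ Set.Icc (0 : ℝ) 1, f x = sin (π * x) * p.eval (cos (π * x)) := by
  set b : ℕ → ℝ := fun m => ∫ x in (0 : ℝ)..1, f x * sin (m * π * x) with hb
  set p : Polynomial ℝ := ∑ j ∈ Finset.range (K - 1),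
    Polynomial.C (2 * b (j + 1)) * Polynomial.Chebyshev.U ℝ (j : ℕ) with hp
  have hev : ∀ x, sin (π * x) * p.eval (cos (π * x)) =
      ∑ j ∈ Finset.range (K - 1), 2 * b (j + 1) * sin ((j + 1 : ℕ) * π * x) := by
    intro x
    rw [hp, Polynomial.eval_finsetSum, Finset.mul_sum]
    refine Finset.sum_congr rfl fun j _ => ?_
    have := Polynomial.Chebyshev.U_real_cos (θ := π * x) (n := (j : ℤ))
    rw [Polynomial.eval_mul, Polynomial.eval_C]
    push_cast at this ⊢
    rw [mul_assoc _ π x, ← this]; ring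
  refine ⟨p, ?_, ?_⟩
  · refine Polynomial.natDegree_sum_le_of_forall_le _ _ fun j hj => ?_
    refine (Polynomial.natDegree_C_mul_le _ _).trans ?_
    rw [Polynomial.Chebyshev.natDegree_U_natCast]
    exact (Finset.mem_range.1 hj).le
  · intro x hx
    refine sub_eq_zero.1 (eq_zero_of_sine_coeff_eq_zero
      (r := fun x => f x - sin (π * x) * p.eval (cos (π * x))) (by fun_prop) (fun m => ?_) x hx)
    simp_rw [hev, sub_mul, Finset.sum_mul, mul_assoc (2 * b _)]
    rw [intervalIntegral.integral_sub (Continuous.intervalIntegrable (by fun_prop) _ _)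
      (Continuous.intervalIntegrable (by fun_prop) _ _), intervalIntegral.integral_finsetSum
      (fun i _ => Continuous.intervalIntegrable (by fun_prop) _ _)]
    simp_rw [intervalIntegral.integral_const_mul, integral_sin_mul_sin _ m (Nat.succ_ne_zero _)]
    rcases m with _ | m
    · simp
    simp only [Nat.succ_eq_add_one, add_left_inj, mul_ite, mul_zero, Finset.sum_ite_eq', Finset.mem_range]
    split_ifs with hm
    · simp only [hb]; ring
    · rw [h _ (by omega)]; simp

/-- Integration by parts twice against `sin (m π x)`. -/
theorem integral_deriv_deriv_mul_sin {f : ℝ → ℝ} (hf : ContDiff ℝ 2 f) (h0 : f 0 = 0)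
    (h1 : f 1 = 0) (m : ℕ) :
    ∫ x in (0 : ℝ)..1, deriv (deriv f) x * sin (m * π * x) =
      -(m * π) ^ 2 * ∫ x in (0 : ℝ)..1, f x * sin (m * π * x) := by
  have hf' : ContDiff ℝ 1 (deriv f) := by
    have : ContDiff ℝ (1 + 1) f := by norm_num; exact hf
    exact (contDiff_succ_iff_deriv.1 this).2.2
  have hf'' : Continuous (deriv (deriv f)) := hf'.continuous_deriv le_rfl
  have hfc : Continuous f := hf.continuous
  have hfc' : Continuous (deriv f) := hf'.continuous
  have hs : ∀ x, HasDerivAt (fun x => sin (m * π * x)) (m * π * cos (m * π * x)) x := fun x => by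
    have := ((hasDerivAt_id x).const_mul (m * π)).sin
    simpa [mul_comm] using this
  have hc : ∀ x, HasDerivAt (fun x => m * π * cos (m * π * x)) (-(m * π) ^ 2 * sin (m * π * x)) x :=
    fun x => by
      have := (((hasDerivAt_id x).const_mul (m * π)).cos).const_mul (m * π)
      refine this.congr_deriv ?_
      simp only [id]; ring
  have e1 := intervalIntegral.integral_deriv_mul_eq_sub (a := 0) (b := 1)
    (fun x _ => (hf'.differentiable one_ne_zero x).hasDerivAt) (fun x _ => hs x)
    (Continuous.intervalIntegrable (by fun_prop) _ _)
    (Continuous.intervalIntegrable (by fun_prop) _ _)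
  have e2 := intervalIntegral.integral_deriv_mul_eq_sub (a := 0) (b := 1)
    (fun x _ => (hf.differentiable two_ne_zero x).hasDerivAt) (fun x _ => hc x)
    (Continuous.intervalIntegrable (by fun_prop) _ _)
    (Continuous.intervalIntegrable (by fun_prop) _ _)
  rw [intervalIntegral.integral_add (Continuous.intervalIntegrable (by fun_prop) _ _)
    (Continuous.intervalIntegrable (by fun_prop) _ _)] at e1 e2
  simp only [mul_one, sin_nat_mul_pi, mul_zero, sin_zero, sub_zero, h0, h1, zero_mul] at e1 e2
  have e3 : ∫ x in (0 : ℝ)..1, f x * (-(m * π) ^ 2 * sin (m * π * x)) =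
      -(m * π) ^ 2 * ∫ x in (0 : ℝ)..1, f x * sin (m * π * x) := by
    rw [← intervalIntegral.integral_const_mul]
    congr 1; ext x; ring
  rw [e3] at e2
  linarith

theorem contDiff_slice_left {φ : ℝ × ℝ → ℝ} (hC2 : ContDiff ℝ 2 φ) (y : ℝ) :
    ContDiff ℝ 2 fun x => φ (x, y) := hC2.comp (contDiff_id.prodMk contDiff_const)

theorem contDiff_slice_right {φ : ℝ × ℝ → ℝ} (hC2 : ContDiff ℝ 2 φ) (x : ℝ) :
    ContDiff ℝ 2 fun y => φ (x, y) := hC2.comp (contDiff_const.prodMk contDiff_id)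

theorem continuous_deriv_deriv_left {φ : ℝ × ℝ → ℝ} (hC2 : ContDiff ℝ 2 φ) :
    Continuous fun p : ℝ × ℝ => deriv (fun x => deriv (fun x' => φ (x', p.2)) x) p.1 := by
  have h1 : ∀ ψ : ℝ × ℝ → ℝ, ContDiff ℝ 1 ψ → ∀ p : ℝ × ℝ,
      deriv (fun x => ψ (x, p.2)) p.1 = fderiv ℝ ψ p (1, 0) := by
    intro ψ hψ p
    have := (hψ.differentiable one_ne_zero (p.1, p.2)).hasFDerivAt.comp_hasDerivAt p.1
      ((hasDerivAt_id p.1).prodMk (hasDerivAt_const p.1 p.2))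
    exact this.deriv
  have h2 : ContDiff ℝ 1 fun p : ℝ × ℝ => fderiv ℝ φ p (1, 0) :=
    (hC2.fderiv_right (m := 1) (by norm_num)).clm_apply contDiff_const
  have h3 : (fun p : ℝ × ℝ => deriv (fun x => deriv (fun x' => φ (x', p.2)) x) p.1) =
      fun p => fderiv ℝ (fun p : ℝ × ℝ => fderiv ℝ φ p (1, 0)) p (1, 0) := by
    ext p
    rw [← h1 _ h2]
    congr 1; ext x
    exact h1 φ (hC2.of_le (by norm_num)) (x, p.2)
  rw [h3]
  exact (h2.continuous_fderiv one_ne_zero).clm_apply continuous_const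

theorem continuous_deriv_deriv_right {φ : ℝ × ℝ → ℝ} (hC2 : ContDiff ℝ 2 φ) :
    Continuous fun p : ℝ × ℝ => deriv (fun y => deriv (fun y' => φ (p.1, y')) y) p.2 :=
  (continuous_deriv_deriv_left (φ := φ ∘ Prod.swap) (hC2.comp (contDiff_snd.prodMk contDiff_fst))).comp continuous_swap

theorem integral_integral_swap_of_continuous {F : ℝ → ℝ → ℝ}
    (hF : Continuous (Function.uncurry F)) :
    ∫ y in (0 : ℝ)..1, ∫ x in (0 : ℝ)..1, F x y = ∫ x in (0 : ℝ)..1, ∫ y in (0 : ℝ)..1, F x y := by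
  simp only [intervalIntegral.integral_of_le zero_le_one]
  refine (MeasureTheory.integral_integral_swap ?_).symm
  rw [MeasureTheory.Measure.prod_restrict]
  refine (hF.continuousOn.integrableOn_compact
    (isCompact_Icc.prod isCompact_Icc : IsCompact (Set.Icc (0 : ℝ) 1 ×ˢ Set.Icc (0 : ℝ) 1))).mono_set
    (Set.prod_mono Set.Ioc_subset_Icc_self Set.Ioc_subset_Icc_self)

/-- The high sine coefficients of the horizontal slices of a Dirichlet eigenfunction vanish. -/
theorem sine_coeff_slice_eq_zero {φ : ℝ × ℝ → ℝ} {lam : ℝ} (hC2 : ContDiff ℝ 2 φ)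
    (heig : ∀ p ∈ Set.Icc (0 : ℝ) 1 ×ˢ Set.Icc (0 : ℝ) 1, laplacian2 φ p = -lam * φ p)
    (hbd : ∀ p ∈ frontier (Set.Icc (0 : ℝ) 1 ×ˢ Set.Icc (0 : ℝ) 1), φ p = 0)
    (m : ℕ) (hm : lam ≤ (m * π) ^ 2) :
    ∀ y ∈ Set.Icc (0 : ℝ) 1, ∫ x in (0 : ℝ)..1, φ (x, y) * sin (m * π * x) = 0 := by
  have hφ : Continuous φ := hC2.continuous
  have hxx := continuous_deriv_deriv_left hC2
  have hyy := continuous_deriv_deriv_right hC2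
  have hb : ∀ p : ℝ × ℝ, p ∈ Set.Icc (0 : ℝ) 1 ×ˢ Set.Icc (0 : ℝ) 1 →
      p.1 = 0 ∨ p.1 = 1 ∨ p.2 = 0 ∨ p.2 = 1 → φ p = 0 := by
    rintro ⟨x, y⟩ hp h
    apply hbd
    rw [frontier, (isClosed_Icc.prod isClosed_Icc).closure_eq, interior_prod_eq, interior_Icc]
    refine ⟨hp, fun h' => ?_⟩
    obtain ⟨⟨a, b⟩, c, d⟩ := h'
    simp only at h a b c d
    rcases h with h | h | h | h <;> linarith
  refine eq_zero_of_sine_coeff_eq_zero ?_ fun j => ?_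
  · exact intervalIntegral.continuous_parametric_intervalIntegral_of_continuous' (by fun_prop) _ _
  rcases Nat.eq_zero_or_pos j with rfl | hj
  · simp
  simp_rw [← intervalIntegral.integral_mul_const]
  set B : ℝ := ∫ y in (0 : ℝ)..1, ∫ x in (0 : ℝ)..1, φ (x, y) * sin (m * π * x) * sin (j * π * y)
    with hB
  have e1 : ∫ y in (0 : ℝ)..1, ∫ x in (0 : ℝ)..1,
      deriv (fun x => deriv (fun x' => φ (x', y)) x) x * sin (m * π * x) * sin (j * π * y) =
      -(m * π) ^ 2 * B := by
    rw [hB, ← intervalIntegral.integral_const_mul]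
    refine intervalIntegral.integral_congr fun y hy => ?_
    rw [Set.uIcc_of_le zero_le_one] at hy
    simp only [intervalIntegral.integral_mul_const]
    have := integral_deriv_deriv_mul_sin (contDiff_slice_left hC2 y)
      (hb (0, y) ⟨by simp, hy⟩ (by simp)) (hb (1, y) ⟨by simp, hy⟩ (by simp)) m
    rw [← mul_assoc, ← this]
  have e2 : ∫ y in (0 : ℝ)..1, ∫ x in (0 : ℝ)..1,
      deriv (fun y => deriv (fun y' => φ (x, y')) y) y * sin (m * π * x) * sin (j * π * y) =
      -(j * π) ^ 2 * B := by
    rw [hB, integral_integral_swap_of_continuous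
      (F := fun x y => deriv (fun y => deriv (fun y' => φ (x, y')) y) y * sin (m * π * x) *
        sin (j * π * y)) ((hyy.mul (by fun_prop)).mul (by fun_prop)),
      integral_integral_swap_of_continuous
      (F := fun x y => φ (x, y) * sin (m * π * x) * sin (j * π * y)) (by fun_prop),
      ← intervalIntegral.integral_const_mul]
    refine intervalIntegral.integral_congr fun x hx => ?_
    rw [Set.uIcc_of_le zero_le_one] at hx
    simp only [mul_right_comm _ (sin (m * π * x)), intervalIntegral.integral_mul_const]
    have := integral_deriv_deriv_mul_sin (contDiff_slice_right hC2 x)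
      (hb (x, 0) ⟨hx, by simp⟩ (by simp)) (hb (x, 1) ⟨hx, by simp⟩ (by simp)) j
    rw [← mul_assoc, ← this]
  have e3 : ∫ y in (0 : ℝ)..1, ∫ x in (0 : ℝ)..1,
      (deriv (fun x => deriv (fun x' => φ (x', y)) x) x * sin (m * π * x) * sin (j * π * y) +
      deriv (fun y => deriv (fun y' => φ (x, y')) y) y * sin (m * π * x) * sin (j * π * y)) =
      -lam * B := by
    rw [hB, ← intervalIntegral.integral_const_mul]
    refine intervalIntegral.integral_congr fun y hy => ?_
    simp only [← intervalIntegral.integral_const_mul]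
    refine intervalIntegral.integral_congr fun x hx => ?_
    rw [Set.uIcc_of_le zero_le_one] at hx hy
    have := heig (x, y) ⟨hx, hy⟩
    simp only [laplacian2] at this
    simp only [← add_mul]
    rw [this]; ring
  have c1 : ∀ y, Continuous fun x =>
      deriv (fun x => deriv (fun x' => φ (x', y)) x) x * sin (m * π * x) * sin (j * π * y) :=
    fun y => ((hxx.comp (by fun_prop : Continuous fun x : ℝ => (x, y))).mul
      (by fun_prop)).mul (by fun_prop)
  have c2 : ∀ y, Continuous fun x =>
      deriv (fun y => deriv (fun y' => φ (x, y')) y) y * sin (m * π * x) * sin (j * π * y) :=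
    fun y => ((hyy.comp (by fun_prop : Continuous fun x : ℝ => (x, y))).mul
      (by fun_prop)).mul (by fun_prop)
  have d1 : Continuous fun y => ∫ x in (0 : ℝ)..1,
      deriv (fun x => deriv (fun x' => φ (x', y)) x) x * sin (m * π * x) * sin (j * π * y) :=
    intervalIntegral.continuous_parametric_intervalIntegral_of_continuous'
      (((hxx.comp continuous_swap).mul (by fun_prop)).mul (by fun_prop)) _ _
  have d2 : Continuous fun y => ∫ x in (0 : ℝ)..1,
      deriv (fun y => deriv (fun y' => φ (x, y')) y) y * sin (m * π * x) * sin (j * π * y) :=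
    intervalIntegral.continuous_parametric_intervalIntegral_of_continuous'
      (((hyy.comp continuous_swap).mul (by fun_prop)).mul (by fun_prop)) _ _
  rw [intervalIntegral.integral_congr fun y _ => intervalIntegral.integral_add
      ((c1 y).intervalIntegrable 0 1) ((c2 y).intervalIntegrable 0 1),
    intervalIntegral.integral_add (d1.intervalIntegrable _ _) (d2.intervalIntegrable _ _),
    e1, e2] at e3
  have hjp : 0 < (j * π) ^ 2 := by have := pi_pos; positivity
  have : (lam - (m * π) ^ 2 - (j * π) ^ 2) * B = 0 := by linarith
  rcases mul_eq_zero.1 this with h | h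
  · linarith
  · exact h

/-- A horizontal slice of a Dirichlet eigenfunction of the square is `sin (π x)` times a polynomial
in `cos (π x)` of controlled degree. -/
theorem exists_polynomial_slice {φ : ℝ × ℝ → ℝ} {lam : ℝ} (hC2 : ContDiff ℝ 2 φ)
    (heig : ∀ p ∈ Set.Icc (0 : ℝ) 1 ×ˢ Set.Icc (0 : ℝ) 1, laplacian2 φ p = -lam * φ p)
    (hbd : ∀ p ∈ frontier (Set.Icc (0 : ℝ) 1 ×ˢ Set.Icc (0 : ℝ) 1), φ p = 0)
    (y : ℝ) (hy : y ∈ Set.Icc (0 : ℝ) 1) :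
    ∃ p : Polynomial ℝ, (p.natDegree : ℝ) ≤ √lam / π ∧
      ∀ x ∈ Set.Icc (0 : ℝ) 1, φ (x, y) = sin (π * x) * p.eval (cos (π * x)) := by
  obtain ⟨p, hp, h⟩ := exists_polynomial_of_sine_coeff_eq_zero
    (contDiff_slice_left hC2 y).continuous ⌈√lam / π⌉₊ fun m hm => by
      refine sine_coeff_slice_eq_zero hC2 heig hbd m ?_ y hy
      have h1 := Nat.ceil_le.1 hm
      rw [div_le_iff₀ pi_pos] at h1
      exact (Real.sqrt_le_left (by have := pi_pos; positivity)).1 h1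
  refine ⟨p, ?_, h⟩
  have h0 : 0 ≤ √lam / π := div_nonneg (sqrt_nonneg _) pi_pos.le
  rcases Nat.eq_zero_or_pos p.natDegree with h' | h'
  · rw [h']; simpa using h0
  · have h1 := Nat.ceil_lt_add_one h0
    have h2 : p.natDegree + 1 ≤ ⌈√lam / π⌉₊ := by omega
    have h3 : (p.natDegree : ℝ) + 1 ≤ (⌈√lam / π⌉₊ : ℝ) := by exact_mod_cast h2
    linarith

/-- A continuous interpolation between two disjoint relatively closed subsets of an open set. -/
theorem exists_separating_function {S C C' : Set (ℝ × ℝ)} (hSne : Sᶜ.Nonempty) (hS : IsOpen S)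
    (hC : ∀ p ∈ S, p ∈ closure C → p ∈ C) (hC' : ∀ p ∈ S, p ∈ closure C' → p ∈ C')
    (hne : C.Nonempty) (hd : Disjoint C C') :
    ∃ τ : ℝ × ℝ → ℝ, ContinuousOn τ S ∧ (∀ p ∈ S, 0 ≤ τ p ∧ τ p ≤ 1) ∧
      (∀ p ∈ S, τ p = 0 ↔ p ∈ C) ∧ ∀ p ∈ S, p ∈ C' → τ p = 1 := by
  set D := C' ∪ Sᶜ with hD
  have hDne : D.Nonempty := hSne.mono Set.subset_union_right
  have h1 : ∀ p ∈ S, Metric.infDist p C = 0 ↔ p ∈ C := fun p hp => by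
    rw [← Metric.mem_closure_iff_infDist_zero hne]
    exact ⟨hC p hp, fun h => subset_closure h⟩
  have h2 : ∀ p ∈ S, Metric.infDist p D = 0 → p ∈ C' := fun p hp => by
    rw [← Metric.mem_closure_iff_infDist_zero hDne, hD, closure_union, hS.isClosed_compl.closure_eq]
    rintro (h | h)
    exacts [hC' p hp h, absurd hp h]
  have h3 : ∀ p, 0 ≤ Metric.infDist p C := fun p => Metric.infDist_nonneg
  have h4 : ∀ p, 0 ≤ Metric.infDist p D := fun p => Metric.infDist_nonneg
  have h5 : ∀ p ∈ S, 0 < Metric.infDist p C + Metric.infDist p D := fun p hp => by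
    rcases (h3 p).lt_or_eq with h | h
    · linarith [h4 p]
    rcases (h4 p).lt_or_eq with h' | h'
    · linarith [h3 p]
    exact absurd (h2 p hp h'.symm) (Set.disjoint_left.1 hd ((h1 p hp).1 h.symm))
  refine ⟨fun p => Metric.infDist p C / (Metric.infDist p C + Metric.infDist p D), ?_, ?_, ?_, ?_⟩
  · refine ContinuousOn.div (Metric.continuous_infDist_pt _).continuousOn
      ((Metric.continuous_infDist_pt _).add (Metric.continuous_infDist_pt _)).continuousOn
      fun p hp => (h5 p hp).ne'
  · exact fun p hp => ⟨div_nonneg (h3 p) (h5 p hp).le, (div_le_one (h5 p hp)).2 (by linarith [h4 p])⟩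
  · intro p hp
    rw [div_eq_zero_iff, or_iff_left (h5 p hp).ne', h1 p hp]
  · intro p hp hp'
    have : Metric.infDist p D = 0 := Metric.infDist_zero_of_mem (Or.inl hp')
    have h := h5 p hp
    simp only [this, add_zero] at h ⊢
    exact div_self h.ne'

/-- In a convex open set, a relatively clopen part `C` of the zero set of `φ` separates: some
integer-valued function which is locally constant off `C` jumps by one across `C`. -/
theorem exists_jump_function {S C C' : Set (ℝ × ℝ)} {φ : ℝ × ℝ → ℝ} (hφ : Continuous φ)
    (hSne : Sᶜ.Nonempty) (hS : IsOpen S) (hconv : Convex ℝ S)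
    (hC : ∀ p ∈ S, p ∈ closure C → p ∈ C) (hC' : ∀ p ∈ S, p ∈ closure C' → p ∈ C')
    (hne : C.Nonempty) (hd : Disjoint C C') (hCS : C ⊆ S) (hC0 : ∀ p ∈ C, φ p = 0)
    (hZ : ∀ p ∈ S, φ p = 0 → p ∈ C ∨ p ∈ C') :
    ∃ k : ℝ × ℝ → ℤ, ContinuousOn k (S \ C) ∧ ∀ z ∈ C, ∃ n : ℤ, ∀ᶠ p in nhds z,
      (0 < φ p → k p = n + 1) ∧ (φ p < 0 → k p = n) := by
  obtain ⟨τ, hτc, hτ01, hτ0, hτ1⟩ := exists_separating_function hSne hS hC hC' hne hd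
  set u : ℝ × ℝ → ℝ := fun p => if 0 < φ p then sin (π * τ p) else -sin (π * τ p) with hu
  have hsin : ∀ p ∈ S, φ p = 0 → sin (π * τ p) = 0 := by
    intro p hp h0
    rcases hZ p hp h0 with h | h
    · rw [(hτ0 p hp).2 h]; simp
    · rw [hτ1 p hp h]; simp
  have huc : ContinuousOn u S := by
    have hs : ContinuousOn (fun p => sin (π * τ p)) S :=
      continuous_sin.comp_continuousOn (continuousOn_const.mul hτc)
    refine ContinuousOn.if ?_ (hs.mono Set.inter_subset_left) (hs.neg.mono Set.inter_subset_left)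
    rintro p ⟨hp, hp'⟩
    have : φ p = 0 := (frontier_lt_subset_eq continuous_const hφ hp').symm
    rw [hsin p hp this]; simp
  set f : ℝ × ℝ → ℂ := fun p => (cos (π * τ p) : ℂ) + (u p : ℂ) * Complex.I with hf
  have hre : ∀ a b : ℝ, ((a : ℂ) + (b : ℂ) * Complex.I).re = a := fun a b => by simp
  have him : ∀ a b : ℝ, ((a : ℂ) + (b : ℂ) * Complex.I).im = b := fun a b => by simp
  have hfre : ∀ p, (f p).re = cos (π * τ p) := fun p => hre _ _
  have hfim : ∀ p, (f p).im = u p := fun p => him _ _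
  have hfc : ContinuousOn f S := by
    have h1 : ContinuousOn (fun p => cos (π * τ p)) S :=
      continuous_cos.comp_continuousOn (continuousOn_const.mul hτc)
    have h2 := Complex.continuous_ofReal.comp_continuousOn h1
    have h3 := Complex.continuous_ofReal.comp_continuousOn huc
    exact h2.add (h3.mul (continuousOn_const (c := Complex.I)))
  have hfn : ∀ p, ‖f p‖ = 1 := by
    intro p
    have h1 : u p ^ 2 = sin (π * τ p) ^ 2 := by simp only [hu]; split_ifs <;> ring
    rw [← sq_eq_sq₀ (norm_nonneg _) zero_le_one, Complex.sq_norm, Complex.normSq_apply, hfre, hfim,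
      ← sq, ← sq, h1]
    simp
  have hf0 : ∀ p, f p ≠ 0 := fun p h => by have := hfn p; rw [h] at this; simp at this
  have hctr : ContractibleSpace S := hconv.contractibleSpace (hne.mono hCS)
  obtain ⟨G, hGc, hG⟩ := Complex.exists_continuousOn_eqOn_exp_comp
    (inferInstance : SimplyConnectedSpace S) hS hfc
    (by rintro ⟨p, -, hp⟩; exact hf0 p hp)
  have hint : ∀ p ∈ S, ∃ n : ℤ, (G p).im = Complex.arg (-f p) + π + n * (2 * π) := by
    intro p hp
    have h1 : Complex.exp (G p) = Complex.exp (((Complex.arg (-f p) + π : ℝ) : ℂ) * Complex.I) := by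
      have h2 := Complex.norm_mul_exp_arg_mul_I (-f p)
      rw [norm_neg, hfn, Complex.ofReal_one, one_mul] at h2
      rw [show Complex.exp (G p) = f p from hG hp, Complex.ofReal_add, add_mul, Complex.exp_add, h2,
        Complex.exp_pi_mul_I]
      ring
    obtain ⟨n, hn⟩ := Complex.exp_eq_exp_iff_exists_int.1 h1
    refine ⟨n, ?_⟩
    rw [hn]
    simp
  choose! k hk using hint
  refine ⟨k, ?_, ?_⟩
  · have h1 : ContinuousOn (fun p => ((G p).im - Complex.arg (-f p) - π) / (2 * π)) (S \ C) := by
      refine ContinuousOn.div_const (((Complex.continuous_im.comp_continuousOn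
        (hGc.mono Set.sdiff_subset)).sub ?_).sub continuousOn_const) _
      intro p hp
      refine ContinuousWithinAt.comp (t := Set.univ) (Complex.continuousAt_arg ?_).continuousWithinAt
        (hfc.neg.mono Set.sdiff_subset p hp) (Set.mapsTo_univ _ _)
      rw [Complex.mem_slitPlane_iff, Complex.neg_re, Complex.neg_im, hfre, hfim]
      by_contra! hcon
      have hs : sin (π * τ p) = 0 := by
        have := hcon.2
        simp only [hu] at this
        split_ifs at this <;> simpa using this
      have ht0 : τ p ≠ 0 := fun h => hp.2 ((hτ0 p hp.1).1 h)
      have ht := hτ01 p hp.1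
      have ht1 : τ p = 1 := by
        by_contra hne1
        have : 0 < sin (π * τ p) := by
          refine sin_pos_of_pos_of_lt_pi (mul_pos pi_pos (ht.1.lt_of_ne' ht0)) ?_
          have := ht.2.lt_of_ne hne1
          nlinarith [pi_pos]
        linarith
      have := hcon.1
      rw [ht1] at this
      simp at this
      linarith
    rw [Int.isClosedEmbedding_coe_real.isEmbedding.continuousOn_iff]
    refine h1.congr fun p hp => ?_
    have := hk p hp.1
    simp only [Function.comp]
    rw [this]
    field_simp
    ring
  · intro z hz
    have hzS := hCS hz
    have hzτ : τ z = 0 := (hτ0 z hzS).2 hz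
    have hfz : f z = 1 := by
      apply Complex.ext
      · rw [hfre, hzτ]; simp
      · rw [hfim]; simp [hu, hzτ]
    obtain ⟨N, hN⟩ : ∃ N : ℤ, (G z).im = N * (2 * π) := by
      obtain ⟨N, hN⟩ := Complex.exp_eq_one_iff.1 ((hG hzS).trans hfz)
      exact ⟨N, by rw [hN]; simp⟩
    refine ⟨N - 1, ?_⟩
    have hSn : S ∈ nhds z := hS.mem_nhds hzS
    have e1 : ∀ᶠ p in nhds z, |(G p).im - N * (2 * π)| < π / 2 := by
      have h1 : ContinuousAt (fun p => |(G p).im - N * (2 * π)|) z :=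
        ((Complex.continuous_im.continuousAt.comp (hGc.continuousAt hSn)).sub continuousAt_const).abs
      refine h1.eventually_lt continuousAt_const ?_
      rw [hN]; simp [pi_pos]
    have e2 : ∀ᶠ p in nhds z, τ p < 1 / 2 :=
      (hτc.continuousAt hSn).eventually_lt continuousAt_const (by rw [hzτ]; norm_num)
    filter_upwards [e1, e2, hSn] with p h1 h2 hp
    have ht := hτ01 p hp
    have hkp := hk p hp
    rw [abs_lt] at h1
    have hπ := pi_pos
    have fin : ∀ a b : ℤ, |((a : ℝ) - b) * (2 * π)| < 2 * π → a = b := by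
      intro a b h
      rw [abs_mul, abs_of_pos (by positivity : 0 < 2 * π)] at h
      have h3 : |((a - b : ℤ) : ℝ)| < 1 := by
        push_cast
        by_contra! h4
        nlinarith
      have h4 : |a - b| < 1 := by exact_mod_cast h3
      have := Int.abs_lt_one_iff.1 h4
      omega
    constructor
    · intro hpos
      have harg : Complex.arg (-f p) = π * τ p - π := by
        have : -f p = (cos (π * τ p - π) : ℂ) + (sin (π * τ p - π) : ℂ) * Complex.I := by
          apply Complex.ext
          · rw [Complex.neg_re, hfre, hre, cos_sub_pi]
          · rw [Complex.neg_im, hfim, him, sin_sub_pi]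
            simp [hu, hpos]
        rw [this]
        have hI : π * τ p - π ∈ Set.Ioc (-π) π := by
          refine ⟨?_, by nlinarith⟩
          have : 0 < τ p := ht.1.lt_of_ne' fun h0 => by
            have := hC0 p ((hτ0 p hp).1 h0); linarith
          nlinarith
        have := Complex.arg_cos_add_sin_mul_I hI
        push_cast at this ⊢
        exact this
      rw [harg] at hkp
      have : k p = N := by
        apply fin
        rw [abs_lt]; constructor <;> nlinarith
      omega
    · intro hneg
      have harg : Complex.arg (-f p) = π - π * τ p := by
        have : -f p = (cos (π - π * τ p) : ℂ) + (sin (π - π * τ p) : ℂ) * Complex.I := by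
          apply Complex.ext
          · rw [Complex.neg_re, hfre, hre, cos_pi_sub]
          · rw [Complex.neg_im, hfim, him, sin_pi_sub]
            simp [hu, hneg.not_gt]
        rw [this]
        have hI : π - π * τ p ∈ Set.Ioc (-π) π := ⟨by nlinarith, by nlinarith⟩
        have := Complex.arg_cos_add_sin_mul_I hI
        push_cast at this ⊢
        exact this
      rw [harg] at hkp
      apply fin
      push_cast
      rw [abs_lt]; constructor <;> nlinarith

/-- Near a regular zero, the zero set and the two sign regions of a function of two variables are
connected. -/
theorem exists_isOpen_isPreconnected_sign {φ : ℝ × ℝ → ℝ} {z : ℝ × ℝ} {φ' : ℝ × ℝ →L[ℝ] ℝ}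
    (hφ : HasStrictFDerivAt φ φ' z) (hz : φ z = 0) (hne : φ' ≠ 0) {N : Set (ℝ × ℝ)}
    (hN : N ∈ nhds z) :
    ∃ U ⊆ N, IsOpen U ∧ z ∈ U ∧ IsPreconnected (U ∩ {p | φ p = 0}) ∧
      IsPreconnected (U ∩ {p | 0 < φ p}) ∧ IsPreconnected (U ∩ {p | φ p < 0}) ∧
      (U ∩ {p | 0 < φ p}).Nonempty ∧ (U ∩ {p | φ p < 0}).Nonempty := by
  set a := φ' (1, 0) with ha
  set b := φ' (0, 1) with hb
  have hφ' : ∀ v : ℝ × ℝ, φ' v = a * v.1 + b * v.2 := by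
    intro v
    have : v = v.1 • ((1, 0) : ℝ × ℝ) + v.2 • ((0, 1) : ℝ × ℝ) := by ext <;> simp
    conv_lhs => rw [this, map_add, map_smul, map_smul]
    simp only [smul_eq_mul, ha, hb]
    ring
  have hd : a ^ 2 + b ^ 2 ≠ 0 := by
    intro h
    apply hne
    have h1 : a = 0 := by nlinarith [sq_nonneg a, sq_nonneg b]
    have h2 : b = 0 := by nlinarith [sq_nonneg a, sq_nonneg b]
    ext <;> simp [← ha, ← hb, h1, h2]
  set g : ℝ × ℝ →L[ℝ] ℝ :=
    (-b) • ContinuousLinearMap.fst ℝ ℝ ℝ + a • ContinuousLinearMap.snd ℝ ℝ ℝ with hg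
  have hgv : ∀ v : ℝ × ℝ, g v = -b * v.1 + a * v.2 := fun v => by simp [hg]
  set g₁ : ℝ × ℝ →L[ℝ] ℝ := (a ^ 2 + b ^ 2)⁻¹ •
    (a • ContinuousLinearMap.fst ℝ ℝ ℝ + (-b) • ContinuousLinearMap.snd ℝ ℝ ℝ) with hg₁
  set g₂ : ℝ × ℝ →L[ℝ] ℝ := (a ^ 2 + b ^ 2)⁻¹ •
    (b • ContinuousLinearMap.fst ℝ ℝ ℝ + a • ContinuousLinearMap.snd ℝ ℝ ℝ) with hg₂
  have hg₁v : ∀ v : ℝ × ℝ, g₁ v = (a ^ 2 + b ^ 2)⁻¹ * (a * v.1 + -b * v.2) := fun v => by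
    simp [hg₁]; ring
  have hg₂v : ∀ v : ℝ × ℝ, g₂ v = (a ^ 2 + b ^ 2)⁻¹ * (b * v.1 + a * v.2) := fun v => by
    simp [hg₂]; ring
  let L : (ℝ × ℝ) ≃L[ℝ] (ℝ × ℝ) := ContinuousLinearEquiv.equivOfInverse (φ'.prod g) (g₁.prod g₂)
    (fun v => by
      ext
      · simp only [ContinuousLinearMap.prod_apply, hg₁v, hφ', hgv]; field_simp; ring
      · simp only [ContinuousLinearMap.prod_apply, hg₂v, hφ', hgv]; field_simp; ring)
    (fun v => by
      ext
      · simp only [ContinuousLinearMap.prod_apply, hg₁v, hg₂v, hφ', hgv]; field_simp; ring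
      · simp only [ContinuousLinearMap.prod_apply, hg₁v, hg₂v, hφ', hgv]; field_simp; ring)
  have hF : HasStrictFDerivAt (fun p => (φ p, g p)) (L : ℝ × ℝ →L[ℝ] ℝ × ℝ) z :=
    hφ.prodMk g.hasStrictFDerivAt
  set e := hF.toOpenPartialHomeomorph (fun p => (φ p, g p)) with he
  have hez : z ∈ e.source := hF.mem_toOpenPartialHomeomorph_source
  have hcoe : ∀ p, e p = (φ p, g p) := fun p => by rw [he, hF.toOpenPartialHomeomorph_coe]
  have hnb : e.target ∩ e.symm ⁻¹' N ∈ nhds (e z) := by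
    refine Filter.inter_mem (e.open_target.mem_nhds (e.map_source hez)) ?_
    refine (e.continuousAt_symm (e.map_source hez)).preimage_mem_nhds ?_
    rwa [e.left_inv hez]
  obtain ⟨ε, hε, hball⟩ := Metric.mem_nhds_iff.1 hnb
  set B := Metric.ball (e z) ε with hB
  have hBt : B ⊆ e.target := fun q hq => (hball hq).1
  have hφe : ∀ q ∈ B, φ (e.symm q) = q.1 := fun q hq => by
    have := congrArg Prod.fst (e.right_inv (hBt hq))
    rwa [hcoe] at this
  have himg : ∀ s : Set ℝ, (e.symm '' B) ∩ {p | φ p ∈ s} = e.symm '' (B ∩ {q | q.1 ∈ s}) := by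
    intro s
    ext p
    constructor
    · rintro ⟨⟨q, hq, rfl⟩, hp⟩
      exact ⟨q, ⟨hq, by simpa [hφe q hq] using hp⟩, rfl⟩
    · rintro ⟨q, ⟨hq, hqs⟩, rfl⟩
      exact ⟨⟨q, hq, rfl⟩, by simpa [hφe q hq] using hqs⟩
  have hpre : ∀ s : Set ℝ, Convex ℝ s → IsPreconnected ((e.symm '' B) ∩ {p | φ p ∈ s}) := by
    intro s hs
    rw [himg]
    refine IsPreconnected.image ?_ _ (e.continuousOn_symm.mono fun q hq => hBt hq.1)
    exact ((convex_ball _ _).inter (hs.linear_preimage (LinearMap.fst ℝ ℝ ℝ))).isPreconnected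
  have hmem : ∀ t : ℝ, |t| < ε → ((t, (e z).2) : ℝ × ℝ) ∈ B := by
    intro t ht
    rw [hB, Metric.mem_ball, Prod.dist_eq, max_lt_iff]
    refine ⟨?_, by simpa using hε⟩
    rw [hcoe, hz, Real.dist_eq]; simpa using ht
  refine ⟨e.symm '' B, ?_, ?_, ?_, hpre {0} (convex_singleton 0), hpre (Set.Ioi 0) (convex_Ioi 0),
    hpre (Set.Iio 0) (convex_Iio 0), ?_, ?_⟩
  · rintro _ ⟨q, hq, rfl⟩
    exact (hball hq).2
  · exact e.isOpen_image_symm_of_subset_target Metric.isOpen_ball hBt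
  · exact ⟨e z, Metric.mem_ball_self hε, e.left_inv hez⟩
  · have := hmem (ε / 2) (by rw [abs_of_pos (half_pos hε)]; linarith)
    exact ⟨_, ⟨_, this, rfl⟩, by simp [hφe _ this, hε]⟩
  · have := hmem (-(ε / 2)) (by rw [abs_neg, abs_of_pos (half_pos hε)]; linarith)
    exact ⟨_, ⟨_, this, rfl⟩, by simp [hφe _ this, hε]⟩

/-- A locally constant function on a preconnected set is constant. -/
theorem IsPreconnected.eq_of_eventually_eq {X Y : Type*} [TopologicalSpace X] {s : Set X}
    (hs : IsPreconnected s) {f : X → Y} (hf : ∀ p ∈ s, ∀ᶠ q in nhdsWithin p s, f q = f p)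
    {p q : X} (hp : p ∈ s) (hq : q ∈ s) : f p = f q := by
  let _ : TopologicalSpace Y := ⊥
  have _ : DiscreteTopology Y := ⟨rfl⟩
  refine hs.constant (f := f) (fun x hx => ?_) hp hq
  exact tendsto_const_nhds.congr' ((hf x hx).mono fun _ h => h.symm)

/-- In a connected open set, the number of nodal domains of a function whose zeros are all regular
is at most one more than the number of components of its zero set. -/
theorem nodal_domains_finite_and_ncard_le {S : Set (ℝ × ℝ)} {φ : ℝ × ℝ → ℝ} (hS : IsOpen S)
    (hSc : IsPreconnected S) (hφ : Continuous φ)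
    (hloc : ∀ z ∈ S, φ z = 0 → ∀ N ∈ nhds z, ∃ U ⊆ N, IsOpen U ∧ z ∈ U ∧
      IsPreconnected (U ∩ {p | φ p = 0}) ∧ IsPreconnected (U ∩ {p | 0 < φ p}) ∧
      IsPreconnected (U ∩ {p | φ p < 0}) ∧ (U ∩ {p | 0 < φ p}).Nonempty ∧
      (U ∩ {p | φ p < 0}).Nonempty)
    (hne : ∃ p ∈ S, φ p ≠ 0)
    (hE : {C | ∃ z ∈ {p | p ∈ S ∧ φ p = 0},
      connectedComponentIn {p | p ∈ S ∧ φ p = 0} z = C}.Finite) :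
    {C | ∃ z ∈ {p | p ∈ S ∧ φ p ≠ 0}, connectedComponentIn {p | p ∈ S ∧ φ p ≠ 0} z = C}.Finite ∧
    {C | ∃ z ∈ {p | p ∈ S ∧ φ p ≠ 0},
      connectedComponentIn {p | p ∈ S ∧ φ p ≠ 0} z = C}.ncard ≤
    {C | ∃ z ∈ {p | p ∈ S ∧ φ p = 0},
      connectedComponentIn {p | p ∈ S ∧ φ p = 0} z = C}.ncard + 1 := by
  classical
  set Z := {p | p ∈ S ∧ φ p = 0} with hZ
  set N := {p | p ∈ S ∧ φ p ≠ 0} with hN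
  set V := {C | ∃ z ∈ N, connectedComponentIn N z = C} with hV
  set E := {C | ∃ z ∈ Z, connectedComponentIn Z z = C} with hEd
  have hNo : IsOpen N := hS.inter (isOpen_ne_fun hφ continuous_const)
  obtain ⟨p₀, hp₀S, hp₀⟩ := hne
  let v₀ : V := ⟨_, p₀, ⟨hp₀S, hp₀⟩, rfl⟩
  have hside : ∀ z ∈ Z, ∃ P M : V, ∀ᶠ p in nhds z,
      (0 < φ p → connectedComponentIn N p = P) ∧ (φ p < 0 → connectedComponentIn N p = M) := by
    intro z hz
    obtain ⟨U, hUS, hUo, hzU, -, hpos, hneg, ⟨a, ha⟩, ⟨b, hb⟩⟩ :=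
      hloc z hz.1 hz.2 S (hS.mem_nhds hz.1)
    refine ⟨⟨_, a, ⟨hUS ha.1, ha.2.ne'⟩, rfl⟩, ⟨_, b, ⟨hUS hb.1, hb.2.ne⟩, rfl⟩, ?_⟩
    filter_upwards [hUo.mem_nhds hzU] with p hp
    constructor
    · intro h
      exact (connectedComponentIn_eq (hpos.subset_connectedComponentIn ha
        (fun q hq => ⟨hUS hq.1, ne_of_gt hq.2⟩ : _ ⊆ N) ⟨hp, h⟩)).symm
    · intro h
      exact (connectedComponentIn_eq (hneg.subset_connectedComponentIn hb
        (fun q hq => ⟨hUS hq.1, ne_of_lt hq.2⟩ : _ ⊆ N) ⟨hp, h⟩)).symm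
  have : ∃ P M : ℝ × ℝ → V, ∀ z ∈ Z, ∀ᶠ p in nhds z,
      (0 < φ p → connectedComponentIn N p = P z) ∧
      (φ p < 0 → connectedComponentIn N p = M z) := by
    choose P M h using fun z => show ∃ P M : V, z ∈ Z → ∀ᶠ p in nhds z,
      (0 < φ p → connectedComponentIn N p = P) ∧ (φ p < 0 → connectedComponentIn N p = M) by
        by_cases hz : z ∈ Z
        · obtain ⟨P, M, h⟩ := hside z hz
          exact ⟨P, M, fun _ => h⟩
        · exact ⟨v₀, v₀, fun h => absurd h hz⟩
    exact ⟨P, M, h⟩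
  obtain ⟨P, M, hPM⟩ := this
  have hfreq : ∀ z ∈ Z, (∃ᶠ p in nhds z, 0 < φ p) ∧ ∃ᶠ p in nhds z, φ p < 0 := by
    intro z hz
    constructor
    · rw [Filter.frequently_iff]
      intro A hA
      obtain ⟨U, hUA, -, -, -, -, -, ⟨a, ha⟩, -⟩ := hloc z hz.1 hz.2 A hA
      exact ⟨a, hUA ha.1, ha.2⟩
    · rw [Filter.frequently_iff]
      intro A hA
      obtain ⟨U, hUA, -, -, -, -, -, -, ⟨a, ha⟩⟩ := hloc z hz.1 hz.2 A hA
      exact ⟨a, hUA ha.1, ha.2⟩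
  have hPMc : ∀ z ∈ Z, ∀ᶠ w in nhds z, w ∈ Z → (P w = P z ∧ M w = M z) := by
    intro z hz
    filter_upwards [(hPM z hz).eventually_nhds] with w hw hwZ
    obtain ⟨p, hp, h1, h2⟩ := ((hfreq w hwZ).1.and_eventually (hw.and (hPM w hwZ))).exists
    obtain ⟨q, hq, h3, h4⟩ := ((hfreq w hwZ).2.and_eventually (hw.and (hPM w hwZ))).exists
    exact ⟨Subtype.ext ((h2.1 hp).symm.trans (h1.1 hp)), Subtype.ext ((h4.2 hq).symm.trans (h3.2 hq))⟩
  let G : SimpleGraph V := SimpleGraph.fromRel fun a b => ∃ z ∈ Z, P z = a ∧ M z = b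
  let v : ℝ × ℝ → V := fun p => if h : p ∈ N then ⟨_, p, h, rfl⟩ else P p
  have hvN : ∀ p ∈ N, (v p : Set (ℝ × ℝ)) = connectedComponentIn N p := fun p hp => by
    simp only [v, dif_pos hp]
  have hvZ : ∀ p ∈ Z, v p = P p := fun p hp => by
    have : p ∉ N := fun h => h.2 hp.2
    simp only [v, dif_neg this]
  have hPMr : ∀ z ∈ Z, G.Reachable (P z) (M z) := by
    intro z hz
    by_cases h : P z = M z
    · rw [h]
    · exact SimpleGraph.Adj.reachable ⟨h, Or.inl ⟨z, hz, rfl, rfl⟩⟩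
  have hGc : G.Connected := by
    refine (SimpleGraph.connected_iff _).2 ⟨?_, ⟨v₀⟩⟩
    have key : ∀ p ∈ S, ∀ᶠ q in nhdsWithin p S,
        G.connectedComponentMk (v q) = G.connectedComponentMk (v p) := by
      intro p hp
      by_cases h0 : φ p = 0
      · filter_upwards [self_mem_nhdsWithin, nhdsWithin_le_nhds (hPM p ⟨hp, h0⟩),
          nhdsWithin_le_nhds (hPMc p ⟨hp, h0⟩)] with q hq h1 h2
        rw [hvZ p ⟨hp, h0⟩]
        rcases lt_trichotomy (φ q) 0 with h | h | h
        · have : v q = M p := Subtype.ext ((hvN q ⟨hq, h.ne⟩).trans (h1.2 h))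
          rw [this]
          exact (SimpleGraph.ConnectedComponent.sound (hPMr p ⟨hp, h0⟩)).symm
        · rw [hvZ q ⟨hq, h⟩, (h2 ⟨hq, h⟩).1]
        · have : v q = P p := Subtype.ext ((hvN q ⟨hq, h.ne'⟩).trans (h1.1 h))
          rw [this]
      · have hpN : p ∈ N := ⟨hp, h0⟩
        have : connectedComponentIn N p ∈ nhds p :=
          hNo.connectedComponentIn.mem_nhds (mem_connectedComponentIn hpN)
        filter_upwards [nhdsWithin_le_nhds this] with q hq
        have hqN : q ∈ N := connectedComponentIn_subset _ _ hq
        have : v q = v p := Subtype.ext (by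
          rw [hvN q hqN, hvN p hpN]; exact (connectedComponentIn_eq hq).symm)
        rw [this]
    rintro ⟨_, p, hp, rfl⟩ ⟨_, q, hq, rfl⟩
    have h := hSc.eq_of_eventually_eq key hp.1 hq.1
    rw [SimpleGraph.ConnectedComponent.eq] at h
    have h1 : v p = ⟨_, p, hp, rfl⟩ := Subtype.ext (hvN p hp)
    have h2 : v q = ⟨_, q, hq, rfl⟩ := Subtype.ext (hvN q hq)
    rwa [h1, h2] at h
  choose! r hrZ hr using fun C => show C ∈ E → ∃ z ∈ Z, connectedComponentIn Z z = C from id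
  have hedge : G.edgeSet ⊆ (fun C => s(P (r C), M (r C))) '' E := by
    have hz' : ∀ z ∈ Z, s(P z, M z) ∈ (fun C => s(P (r C), M (r C))) '' E := by
      intro z hz
      set C := connectedComponentIn Z z with hC
      have hCE : C ∈ E := ⟨z, hz, rfl⟩
      refine ⟨C, hCE, ?_⟩
      have h1 : z ∈ C := mem_connectedComponentIn hz
      have h2 : r C ∈ C := by
        have := mem_connectedComponentIn (hrZ C hCE)
        rwa [hr C hCE] at this
      have hCZ : C ⊆ Z := connectedComponentIn_subset _ _
      have h3 : P (r C) = P z := isPreconnected_connectedComponentIn.eq_of_eventually_eq (f := P)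
        (fun p hp => by
          filter_upwards [self_mem_nhdsWithin, nhdsWithin_le_nhds (hPMc p (hCZ hp))] with q hq h
          exact (h (hCZ hq)).1) h2 h1
      have h4 : M (r C) = M z := isPreconnected_connectedComponentIn.eq_of_eventually_eq (f := M)
        (fun p hp => by
          filter_upwards [self_mem_nhdsWithin, nhdsWithin_le_nhds (hPMc p (hCZ hp))] with q hq h
          exact (h (hCZ hq)).2) h2 h1
      simp only [h3, h4]
    intro e
    induction e using Sym2.ind with
    | _ a b =>
      rintro ⟨-, ⟨z, hz, rfl, rfl⟩ | ⟨z, hz, rfl, rfl⟩⟩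
      · exact hz' z hz
      · rw [Sym2.eq_swap]; exact hz' z hz
  have hefin : G.edgeSet.Finite := (hE.image _).subset hedge
  have hcard : G.edgeSet.ncard ≤ E.ncard :=
    (Set.ncard_le_ncard hedge (hE.image _)).trans (Set.ncard_image_le hE)
  have hVfin : Finite V := by
    have hsub : (Set.univ : Set V) ⊆ {v₀} ∪ ⋃ e ∈ G.edgeSet, {x | x ∈ e} := by
      intro x _
      obtain ⟨w⟩ := hGc.preconnected x v₀
      cases w with
      | nil => exact Or.inl rfl
      | cons h _ =>
        refine Or.inr (Set.mem_biUnion ((SimpleGraph.mem_edgeSet G).2 h) ?_)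
        simp
    refine Set.finite_univ_iff.1 (((Set.finite_singleton v₀).union
      (hefin.biUnion fun e _ => ?_)).subset hsub)
    induction e using Sym2.ind with
    | _ a b =>
      refine (Set.toFinite {a, b}).subset fun x hx => ?_
      simpa using hx
  refine ⟨Set.toFinite V, ?_⟩
  have := hGc.card_vert_le_card_edgeSet_add_one
  rw [Nat.card_coe_set_eq, Nat.card_coe_set_eq] at this
  omega

/-- Second-order necessary condition for a local maximum. -/
theorem deriv_deriv_nonpos_of_isLocalMax {f : ℝ → ℝ} {x : ℝ} (hf : ContinuousAt f x)
    (h : IsLocalMax f x) : deriv (deriv f) x ≤ 0 := by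
  by_contra! hpos
  have hmin := isLocalMin_of_deriv_deriv_pos hpos h.deriv_eq_zero hf
  have hc : f =ᶠ[nhds x] fun _ => f x := by
    filter_upwards [h, hmin] with y h1 h2 using le_antisymm h1 h2
  have : deriv f =ᶠ[nhds x] fun _ => 0 := by
    filter_upwards [hc.eventually_nhds] with y hy
    have hy' : f =ᶠ[nhds y] fun _ => f x := hy
    rw [hy'.deriv_eq, deriv_const]
  rw [this.deriv_eq, deriv_const] at hpos
  exact lt_irrefl _ hpos

theorem pi_le_sqrt_mul_height_of_pos {φ : ℝ × ℝ → ℝ} {lam : ℝ} (hC2 : ContDiff ℝ 2 φ)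
    (hlam : 0 < lam) {W Q : Set (ℝ × ℝ)} (hW : IsOpen W) (hQ : IsCompact Q) (hWQ : W ⊆ Q)
    (h0 : ∀ p ∈ Q, p ∉ W → φ p = 0) (heig : ∀ p ∈ W, laplacian2 φ p = -lam * φ p)
    (hne : ∃ p ∈ W, 0 < φ p) {a b : ℝ} (hab : ∀ p ∈ Q, a ≤ p.2 ∧ p.2 ≤ b) :
    π ≤ √lam * (b - a) := by
  by_contra! hlt
  obtain ⟨p₀, hp₀, hp₀pos⟩ := hne
  have hle : a ≤ b := (hab p₀ (hWQ hp₀)).1.trans (hab p₀ (hWQ hp₀)).2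
  obtain ⟨μ, hμ, hμπ⟩ : ∃ μ, √lam < μ ∧ μ * (b - a) < π := by
    rcases hle.eq_or_lt with h | h
    · exact ⟨√lam + 1, by linarith, by rw [h]; simpa using pi_pos⟩
    · have h' : 0 < b - a := sub_pos.2 h
      obtain ⟨μ, h1, h2⟩ := exists_between ((lt_div_iff₀ h').2 hlt)
      exact ⟨μ, h1, (lt_div_iff₀ h').1 h2⟩
  have hsl : 0 < √lam := Real.sqrt_pos.2 hlam
  have hμ0 : 0 < μ := hsl.trans hμ
  have hμ2 : lam < μ ^ 2 := by
    nlinarith [Real.sq_sqrt hlam.le]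
  set c := (a + b) / 2 with hc
  set s : ℝ → ℝ := fun y => cos (μ * (y - c)) with hs
  have hspos : ∀ y, a ≤ y → y ≤ b → 0 < s y := by
    intro y h1 h2
    apply cos_pos_of_mem_Ioo
    constructor <;> rw [hc] <;> nlinarith
  have hsc : Continuous s := by fun_prop
  have hcont : ContinuousOn (fun p : ℝ × ℝ => φ p / s p.2) Q :=
    hC2.continuous.continuousOn.div (hsc.comp continuous_snd).continuousOn
      fun p hp => (hspos p.2 (hab p hp).1 (hab p hp).2).ne'
  obtain ⟨q, hqQ, hq⟩ := hQ.exists_isMaxOn ⟨p₀, hWQ hp₀⟩ hcont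
  set m := φ q / s q.2 with hm
  have hsq := hspos q.2 (hab q hqQ).1 (hab q hqQ).2
  have hmpos : 0 < m := by
    have h1 : φ p₀ / s p₀.2 ≤ m := hq (hWQ hp₀)
    have := hspos p₀.2 (hab p₀ (hWQ hp₀)).1 (hab p₀ (hWQ hp₀)).2
    exact lt_of_lt_of_le (div_pos hp₀pos this) h1
  have hφq : φ q = m * s q.2 := by rw [hm]; field_simp
  have hφqpos : 0 < φ q := hφq ▸ mul_pos hmpos hsq
  have hqW : q ∈ W := by
    by_contra h
    exact hφqpos.ne' (h0 q hqQ h)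
  have hmax : ∀ᶠ p in nhds q, φ p - m * s p.2 ≤ φ q - m * s q.2 := by
    filter_upwards [hW.mem_nhds hqW] with p hp
    have h1 : φ p / s p.2 ≤ m := hq (hWQ hp)
    have := hspos p.2 (hab p (hWQ hp)).1 (hab p (hWQ hp)).2
    rw [div_le_iff₀ this] at h1
    linarith
  have e1 : deriv (fun x => deriv (fun x' => φ (x', q.2)) x) q.1 ≤ 0 := by
    refine deriv_deriv_nonpos_of_isLocalMax (f := fun x => φ (x, q.2))
      (contDiff_slice_left hC2 q.2).continuous.continuousAt ?_
    have ht : Filter.Tendsto (fun x : ℝ => (x, q.2)) (nhds q.1) (nhds q) :=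
      (Continuous.prodMk_left q.2).tendsto q.1
    filter_upwards [ht.eventually hmax] with x hx
    linarith
  have hd1 : ∀ y, HasDerivAt s (-μ * sin (μ * (y - c))) y := by
    intro y
    have := (((hasDerivAt_id y).sub_const c).const_mul μ).cos
    exact this.congr_deriv (by simp; ring)
  have hd2 : HasDerivAt (fun y => -μ * sin (μ * (y - c))) (-μ ^ 2 * s q.2) q.2 := by
    have := ((((hasDerivAt_id q.2).sub_const c).const_mul μ).sin).const_mul (-μ)
    exact this.congr_deriv (by simp [hs]; ring)
  have hslice := contDiff_slice_right hC2 q.1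
  have e2 : deriv (fun y => deriv (fun y' => φ (q.1, y')) y) q.2 + m * μ ^ 2 * s q.2 ≤ 0 := by
    have hfd : ∀ y, HasDerivAt (fun y => φ (q.1, y) - m * s y)
        (deriv (fun y' => φ (q.1, y')) y - m * (-μ * sin (μ * (y - c)))) y := fun y =>
      ((hslice.differentiable two_ne_zero y).hasDerivAt).sub ((hd1 y).const_mul m)
    have hdd : DifferentiableAt ℝ (fun y => deriv (fun y' => φ (q.1, y')) y) q.2 := by
      have h2 : ContDiff ℝ (1 + 1) fun y' => φ (q.1, y') := by norm_num; exact hslice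
      exact (contDiff_succ_iff_deriv.1 h2).2.2.differentiable one_ne_zero q.2
    have hfdd := hdd.hasDerivAt.sub (hd2.const_mul m)
    have hmx : IsLocalMax (fun y => φ (q.1, y) - m * s y) q.2 := by
      have ht : Filter.Tendsto (fun y : ℝ => (q.1, y)) (nhds q.2) (nhds q) :=
        (Continuous.prodMk_right q.1).tendsto q.2
      filter_upwards [ht.eventually hmax] with y hy
      exact hy
    have h3 := deriv_deriv_nonpos_of_isLocalMax (hfd q.2).continuousAt hmx
    rw [show deriv (fun y => φ (q.1, y) - m * s y) = fun y =>
      deriv (fun y' => φ (q.1, y')) y - m * (-μ * sin (μ * (y - c))) from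
        funext fun y => (hfd y).deriv] at h3
    have h4 := hfdd.deriv
    change deriv (fun y => deriv (fun y' => φ (q.1, y')) y - m * (-μ * sin (μ * (y - c)))) q.2 = _
      at h4
    rw [h4] at h3
    linarith
  have h5 := heig q hqW
  unfold laplacian2 at h5
  nlinarith

/-- A region on whose boundary a solution of `Δφ = -λφ` vanishes, while `φ` does not vanish
identically inside, cannot fit in a strip of height less than `π / √λ`. -/
theorem pi_le_sqrt_mul_height {φ : ℝ × ℝ → ℝ} {lam : ℝ} (hC2 : ContDiff ℝ 2 φ)
    (hlam : 0 < lam) {W Q : Set (ℝ × ℝ)} (hW : IsOpen W) (hQ : IsCompact Q) (hWQ : W ⊆ Q)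
    (h0 : ∀ p ∈ Q, p ∉ W → φ p = 0) (heig : ∀ p ∈ W, laplacian2 φ p = -lam * φ p)
    (hne : ∃ p ∈ W, φ p ≠ 0) {a b : ℝ} (hab : ∀ p ∈ Q, a ≤ p.2 ∧ p.2 ≤ b) :
    π ≤ √lam * (b - a) := by
  obtain ⟨p, hp, hne⟩ := hne
  rcases hne.lt_or_gt with h | h
  · refine pi_le_sqrt_mul_height_of_pos (φ := fun p => -φ p) hC2.neg hlam hW hQ hWQ
      (fun p hp h' => by simp [h0 p hp h']) (fun p hp => ?_) ⟨p, hp, by simpa using h⟩ hab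
    have := heig p hp
    simp only [laplacian2, deriv.fun_neg] at this ⊢
    linarith
  · exact pi_le_sqrt_mul_height_of_pos hC2 hlam hW hQ hWQ h0 heig ⟨p, hp, h⟩ hab

open Classical in
/-- The number of roots of `p` of the form `cos (π x)` with `x ∈ A`, with multiplicity. -/
noncomputable def cosRootCount (p : Polynomial ℝ) (A : Set ℝ) : ℕ :=
  (p.roots.filter fun r => arccos r / π ∈ A).card

theorem arccos_cos_pi_mul_div {x : ℝ} (hx : x ∈ Set.Icc (0 : ℝ) 1) :
    arccos (cos (π * x)) / π = x := by
  rw [arccos_cos (mul_nonneg pi_pos.le hx.1) (by nlinarith [hx.2, pi_pos])]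
  field_simp

theorem sum_cosRootCount_le {ι : Type*} (T : Finset ι) (A : ι → Set ℝ)
    (hA : (T : Set ι).PairwiseDisjoint A) (p : Polynomial ℝ) :
    ∑ i ∈ T, cosRootCount p (A i) ≤ p.natDegree := by
  classical
  refine le_trans ?_ p.card_roots'
  unfold cosRootCount
  induction p.roots using Multiset.induction with
  | empty => simp
  | cons r s ih =>
    have h1 : ∀ i, (Multiset.filter (fun r => arccos r / π ∈ A i) (r ::ₘ s)).card =
        (Multiset.filter (fun r => arccos r / π ∈ A i) s).card +
          if arccos r / π ∈ A i then 1 else 0 := by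
      intro i
      rw [Multiset.filter_cons]
      split_ifs <;> simp [add_comm]
    have h2 : ∑ i ∈ T, (if arccos r / π ∈ A i then 1 else 0) ≤ 1 := by
      rw [Finset.sum_boole, Nat.cast_id, Finset.card_le_one]
      intro i hi j hj
      rw [Finset.mem_filter] at hi hj
      by_contra hij
      exact Set.disjoint_left.1 (hA hi.1 hj.1 hij) hi.2 hj.2
    have h3 : ∀ i ∈ T, (Multiset.filter (fun r => arccos r / π ∈ A i) (r ::ₘ s)).card =
        (Multiset.filter (fun r => arccos r / π ∈ A i) s).card +
          if arccos r / π ∈ A i then 1 else 0 := fun i _ => h1 i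
    have h4 := Finset.sum_congr rfl h3
    rw [Finset.sum_add_distrib] at h4
    rw [Multiset.card_cons]
    refine le_trans (le_of_eq ?_) (Nat.add_le_add ih h2)
    convert h4

theorem one_le_cosRootCount {p : Polynomial ℝ} {A : Set ℝ} (hp : p ≠ 0) {x : ℝ}
    (hx : x ∈ Set.Icc (0 : ℝ) 1) (hxA : x ∈ A) (h0 : p.eval (cos (π * x)) = 0) :
    1 ≤ cosRootCount p A := by
  classical
  refine Nat.succ_le_of_lt (Multiset.card_pos_iff_exists_mem.2 ⟨cos (π * x), ?_⟩)
  rw [Multiset.mem_filter, arccos_cos_pi_mul_div hx]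
  exact ⟨(Polynomial.mem_roots hp).2 h0, hxA⟩

/-- If only one root is counted, it is unique and simple. -/
theorem eval_ne_zero_of_cosRootCount_eq_one {p q : Polynomial ℝ} {A : Set ℝ} (hp : p ≠ 0)
    (h1 : cosRootCount p A = 1) {x : ℝ} (hx : x ∈ Set.Icc (0 : ℝ) 1) (hxA : x ∈ A)
    (hpq : p = (Polynomial.X - Polynomial.C (cos (π * x))) * q) :
    q ≠ 0 ∧ ∀ y ∈ A, y ∈ Set.Icc (0 : ℝ) 1 → q.eval (cos (π * y)) ≠ 0 := by
  classical
  have hq : q ≠ 0 := by rintro rfl; exact hp (by rw [hpq, mul_zero])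
  refine ⟨hq, fun y hyA hy hy0 => ?_⟩
  have h2 := one_le_cosRootCount hq hy hyA hy0
  unfold cosRootCount at h1 h2
  have h3 : p.roots = cos (π * x) ::ₘ q.roots := by
    rw [hpq, Polynomial.roots_mul (hpq ▸ hp), Polynomial.roots_X_sub_C, Multiset.singleton_add]
  rw [h3, Multiset.filter_cons_of_pos _ (by rwa [arccos_cos_pi_mul_div hx]),
    Multiset.card_cons] at h1
  omega

/-- Along a curve, the number of crossings with `C` controls the change of the jump function. -/
theorem jump_of_cosRootCount {C : Set (ℝ × ℝ)} {φ : ℝ × ℝ → ℝ} {k : ℝ × ℝ → ℤ}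
    {S : Set (ℝ × ℝ)} (hk : ContinuousOn k (S \ C))
    (hkj : ∀ z ∈ C, ∃ n : ℤ, ∀ᶠ p in nhds z, (0 < φ p → k p = n + 1) ∧ (φ p < 0 → k p = n))
    (hC0 : ∀ z ∈ C, φ z = 0) {γ : ℝ → ℝ × ℝ} (hγ : Continuous γ) {s t : ℝ} (hs : 0 < s)
    (hst : s ≤ t) (ht : t < 1) (hγS : ∀ x ∈ Set.Icc s t, γ x ∈ S) {p : Polynomial ℝ} (hp : p ≠ 0)
    (hpφ : ∀ x ∈ Set.Icc (0 : ℝ) 1, φ (γ x) = sin (π * x) * p.eval (cos (π * x))) :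
    (cosRootCount p {x | x ∈ Set.Icc s t ∧ γ x ∈ C} = 0 →
      (∀ x ∈ Set.Icc s t, γ x ∉ C) ∧ k (γ s) = k (γ t)) ∧
    (cosRootCount p {x | x ∈ Set.Icc s t ∧ γ x ∈ C} = 1 → γ s ∉ C → γ t ∉ C →
      k (γ s) ≠ k (γ t)) := by
  set A := {x | x ∈ Set.Icc s t ∧ γ x ∈ C} with hA
  have hI : ∀ x ∈ Set.Icc s t, x ∈ Set.Icc (0 : ℝ) 1 := fun x hx =>
    ⟨hs.le.trans hx.1, hx.2.trans ht.le⟩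
  have hsin : ∀ x ∈ Set.Icc s t, 0 < sin (π * x) := fun x hx =>
    sin_pos_of_pos_of_lt_pi (mul_pos pi_pos (hs.trans_le hx.1))
      (by nlinarith [pi_pos, hx.2])
  have hAp : ∀ x ∈ A, p.eval (cos (π * x)) = 0 := by
    intro x hx
    have := hpφ x (hI x hx.1)
    rw [hC0 _ hx.2] at this
    rcases mul_eq_zero.1 this.symm with h | h
    · exact absurd h (hsin x hx.1).ne'
    · exact h
  have hconst : ∀ u ⊆ Set.Icc s t, IsPreconnected u → (∀ x ∈ u, γ x ∉ C) →
      ∀ x ∈ u, ∀ y ∈ u, k (γ x) = k (γ y) := by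
    intro u hu huc hun x hx y hy
    refine huc.constant (f := k ∘ γ) ?_ hx hy
    exact hk.comp hγ.continuousOn fun x hx => ⟨hγS x (hu hx), hun x hx⟩
  constructor
  · intro h0
    have hno : ∀ x ∈ Set.Icc s t, γ x ∉ C := by
      intro x hx hxC
      have := one_le_cosRootCount (A := A) hp (hI x hx) ⟨hx, hxC⟩ (hAp x ⟨hx, hxC⟩)
      omega
    exact ⟨hno, hconst _ subset_rfl isPreconnected_Icc hno _ (Set.left_mem_Icc.2 hst) _
      (Set.right_mem_Icc.2 hst)⟩
  · intro h1 hsC htC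
    obtain ⟨x, hx⟩ : ∃ x, x ∈ A := by
      classical
      obtain ⟨r, hr⟩ := Multiset.card_pos_iff_exists_mem.1
        (show 0 < (p.roots.filter fun r => arccos r / π ∈ A).card by
          have h2 : 0 < cosRootCount p A := by omega
          unfold cosRootCount at h2
          convert h2)
      exact ⟨_, (Multiset.mem_filter.1 hr).2⟩
    obtain ⟨q, hpq⟩ := Polynomial.dvd_iff_isRoot.2 (hAp x hx)
    obtain ⟨-, hq⟩ := eval_ne_zero_of_cosRootCount_eq_one hp h1 (hI x hx.1) hx hpq
    have hsx : s < x := hx.1.1.lt_of_ne (by rintro rfl; exact hsC hx.2)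
    have hxt : x < t := hx.1.2.lt_of_ne (by rintro rfl; exact htC hx.2)
    have hcos : ∀ y ∈ Set.Icc s t, ∀ z ∈ Set.Icc s t, y < z → cos (π * z) < cos (π * y) := by
      intro y hy z hz hyz
      exact cos_lt_cos_of_nonneg_of_le_pi (mul_nonneg pi_pos.le (hI y hy).1)
        (by nlinarith [pi_pos, (hI z hz).2]) (mul_lt_mul_of_pos_left hyz pi_pos)
    have huniq : ∀ y ∈ Set.Icc s t, y ≠ x → γ y ∉ C := by
      intro y hy hyx hyC
      have h2 := hAp y ⟨hy, hyC⟩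
      rw [hpq, Polynomial.eval_mul] at h2
      rcases mul_eq_zero.1 h2 with h | h
      · simp only [Polynomial.eval_sub, Polynomial.eval_X, Polynomial.eval_C] at h
        rcases hyx.lt_or_gt with h' | h'
        · linarith [hcos y hy x hx.1 h']
        · linarith [hcos x hx.1 y hy h']
      · exact hq y ⟨hy, hyC⟩ (hI y hy) h
    have hφy : ∀ y ∈ Set.Icc s t, φ (γ y) =
        sin (π * y) * ((cos (π * y) - cos (π * x)) * q.eval (cos (π * y))) := by
      intro y hy
      rw [hpφ y (hI y hy), hpq, Polynomial.eval_mul]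
      simp
    obtain ⟨n, hn⟩ := hkj _ hx.2
    have hn' := (hγ.tendsto x).eventually hn
    have hqx := hq x hx (hI x hx.1)
    have hqc : Continuous fun y : ℝ => q.eval (cos (π * y)) := by fun_prop
    have hkl : ∀ y ∈ Set.Ico s x, k (γ s) = k (γ y) := fun y hy =>
      hconst (Set.Ico s x) (fun z hz => ⟨hz.1, hz.2.le.trans hxt.le⟩) isPreconnected_Ico
        (fun z hz => huniq z ⟨hz.1, hz.2.le.trans hxt.le⟩ hz.2.ne) _ ⟨le_rfl, hsx⟩ _ hy
    have hkr : ∀ y ∈ Set.Ioc x t, k (γ y) = k (γ t) := fun y hy =>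
      hconst (Set.Ioc x t) (fun z hz => ⟨hsx.le.trans hz.1.le, hz.2⟩) isPreconnected_Ioc
        (fun z hz => huniq z ⟨hsx.le.trans hz.1.le, hz.2⟩ hz.1.ne') _ hy _ ⟨hxt, le_rfl⟩
    have hsame : ∀ᶠ y in nhds x, 0 < q.eval (cos (π * x)) * q.eval (cos (π * y)) :=
      (continuousAt_const.mul hqc.continuousAt).eventually_const_lt (mul_self_pos.2 hqx)
    obtain ⟨y, ⟨hy1, hy2⟩, hyI⟩ := ((hn'.and hsame).filter_mono nhdsWithin_le_nhds).and
      (Ico_mem_nhdsLT hsx) |>.exists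
    obtain ⟨z, ⟨hz1, hz2⟩, hzI⟩ := ((hn'.and hsame).filter_mono nhdsWithin_le_nhds).and
      (Ioc_mem_nhdsGT hxt) |>.exists
    have hyI' : y ∈ Set.Icc s t := ⟨hyI.1, hyI.2.le.trans hxt.le⟩
    have hzI' : z ∈ Set.Icc s t := ⟨hsx.le.trans hzI.1.le, hzI.2⟩
    have hcy := hcos y hyI' x hx.1 hyI.2
    have hcz := hcos x hx.1 z hzI' hzI.1
    rw [hkl y hyI, ← hkr z hzI]
    rw [hφy y hyI'] at hy1
    rw [hφy z hzI'] at hz1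
    rcases hqx.lt_or_gt with h | h
    · have h3 := neg_of_mul_pos_right hy2 h.le
      have h4 := neg_of_mul_pos_right hz2 h.le
      have h5 := hy1.2 (mul_neg_of_pos_of_neg (hsin y hyI')
        (mul_neg_of_pos_of_neg (by linarith) h3))
      have h6 := hz1.1 (mul_pos (hsin z hzI') (mul_pos_of_neg_of_neg (by linarith) h4))
      omega
    · have h3 := pos_of_mul_pos_right hy2 h.le
      have h4 := pos_of_mul_pos_right hz2 h.le
      have h5 := hy1.1 (mul_pos (hsin y hyI') (mul_pos (by linarith) h3))
      have h6 := hz1.2 (mul_neg_of_pos_of_neg (hsin z hzI')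
        (mul_neg_of_neg_of_pos (by linarith) h4))
      omega

/-- A relatively clopen part of the zero set which meets the boundary of a square meets it at least
twice, counted with multiplicity. -/
theorem two_le_boundary_count {C : Set (ℝ × ℝ)} {φ : ℝ × ℝ → ℝ} {k : ℝ × ℝ → ℤ}
    (hk : ContinuousOn k ((Set.Ioo (0 : ℝ) 1 ×ˢ Set.Ioo (0 : ℝ) 1) \ C))
    (hkj : ∀ z ∈ C, ∃ n : ℤ, ∀ᶠ p in nhds z, (0 < φ p → k p = n + 1) ∧ (φ p < 0 → k p = n))
    (hC0 : ∀ z ∈ C, φ z = 0) {s t : ℝ} (hs : 0 < s) (hst : s ≤ t) (ht : t < 1)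
    {pb pt pl pr : Polynomial ℝ} (hpb : pb ≠ 0) (hpt : pt ≠ 0) (hpl : pl ≠ 0) (hpr : pr ≠ 0)
    (hb : ∀ x ∈ Set.Icc (0 : ℝ) 1, φ (x, s) = sin (π * x) * pb.eval (cos (π * x)))
    (htp : ∀ x ∈ Set.Icc (0 : ℝ) 1, φ (x, t) = sin (π * x) * pt.eval (cos (π * x)))
    (hl : ∀ x ∈ Set.Icc (0 : ℝ) 1, φ (s, x) = sin (π * x) * pl.eval (cos (π * x)))
    (hr : ∀ x ∈ Set.Icc (0 : ℝ) 1, φ (t, x) = sin (π * x) * pr.eval (cos (π * x))) :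
    2 ≤ cosRootCount pb {x | x ∈ Set.Icc s t ∧ (x, s) ∈ C} +
      cosRootCount pt {x | x ∈ Set.Icc s t ∧ (x, t) ∈ C} +
      cosRootCount pl {x | x ∈ Set.Icc s t ∧ (s, x) ∈ C} +
      cosRootCount pr {x | x ∈ Set.Icc s t ∧ (t, x) ∈ C} ∨
    ∀ x ∈ Set.Icc s t, (x, s) ∉ C ∧ (x, t) ∉ C ∧ (s, x) ∉ C ∧ (t, x) ∉ C := by
  have hI : ∀ x ∈ Set.Icc s t, x ∈ Set.Ioo (0 : ℝ) 1 := fun x hx =>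
    ⟨hs.trans_le hx.1, hx.2.trans_lt ht⟩
  have hsI := Set.left_mem_Icc.2 hst
  have htI := Set.right_mem_Icc.2 hst
  obtain ⟨b0, b1⟩ := jump_of_cosRootCount hk hkj hC0 (γ := fun x => (x, s)) (by fun_prop) hs hst ht
    (fun x hx => ⟨hI x hx, hI s hsI⟩) hpb hb
  obtain ⟨t0, t1⟩ := jump_of_cosRootCount hk hkj hC0 (γ := fun x => (x, t)) (by fun_prop) hs hst ht
    (fun x hx => ⟨hI x hx, hI t htI⟩) hpt htp
  obtain ⟨l0, l1⟩ := jump_of_cosRootCount hk hkj hC0 (γ := fun x => (s, x)) (by fun_prop) hs hst ht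
    (fun x hx => ⟨hI s hsI, hI x hx⟩) hpl hl
  obtain ⟨r0, r1⟩ := jump_of_cosRootCount hk hkj hC0 (γ := fun x => (t, x)) (by fun_prop) hs hst ht
    (fun x hx => ⟨hI t htI, hI x hx⟩) hpr hr
  set wb := cosRootCount pb {x | x ∈ Set.Icc s t ∧ (x, s) ∈ C}
  set wt := cosRootCount pt {x | x ∈ Set.Icc s t ∧ (x, t) ∈ C}
  set wl := cosRootCount pl {x | x ∈ Set.Icc s t ∧ (s, x) ∈ C}
  set wr := cosRootCount pr {x | x ∈ Set.Icc s t ∧ (t, x) ∈ C}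
  by_cases h2 : 2 ≤ wb + wt + wl + wr
  · exact Or.inl h2
  right
  have c1 : (s, s) ∉ C := by
    rcases Nat.eq_zero_or_pos wb with h | h
    · exact (b0 h).1 s hsI
    · exact (l0 (by omega)).1 s hsI
  have c2 : (t, s) ∉ C := by
    rcases Nat.eq_zero_or_pos wb with h | h
    · exact (b0 h).1 t htI
    · exact (r0 (by omega)).1 s hsI
  have c3 : (s, t) ∉ C := by
    rcases Nat.eq_zero_or_pos wt with h | h
    · exact (t0 h).1 s hsI
    · exact (l0 (by omega)).1 t htI
  have c4 : (t, t) ∉ C := by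
    rcases Nat.eq_zero_or_pos wt with h | h
    · exact (t0 h).1 t htI
    · exact (r0 (by omega)).1 t htI
  have zb : wb = 0 := by
    by_contra h
    have e1 := (t0 (by omega)).2
    have e2 := (l0 (by omega)).2
    have e3 := (r0 (by omega)).2
    have e4 := b1 (by omega) c1 c2
    omega
  have zt : wt = 0 := by
    by_contra h
    have e1 := (b0 (by omega)).2
    have e2 := (l0 (by omega)).2
    have e3 := (r0 (by omega)).2
    have e4 := t1 (by omega) c3 c4
    omega
  have zl : wl = 0 := by
    by_contra h
    have e1 := (t0 (by omega)).2
    have e2 := (b0 (by omega)).2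
    have e3 := (r0 (by omega)).2
    have e4 := l1 (by omega) c1 c3
    omega
  have zr : wr = 0 := by
    by_contra h
    have e1 := (t0 (by omega)).2
    have e2 := (l0 (by omega)).2
    have e3 := (b0 (by omega)).2
    have e4 := r1 (by omega) c2 c4
    omega
  exact fun x hx => ⟨(b0 zb).1 x hx, (t0 zt).1 x hx, (l0 zl).1 x hx, (r0 zr).1 x hx⟩

/-- A component of the zero set which lies inside a square avoiding its boundary has height at
least `π / √λ`, and each horizontal line at an intermediate height meets it at least twice. -/
theorem exists_height_interval {C : Set (ℝ × ℝ)} {φ : ℝ × ℝ → ℝ} {k : ℝ × ℝ → ℤ} {lam : ℝ}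
    (hlam : 0 < lam) (hC2 : ContDiff ℝ 2 φ)
    (heig : ∀ p ∈ Set.Ioo (0 : ℝ) 1 ×ˢ Set.Ioo (0 : ℝ) 1, laplacian2 φ p = -lam * φ p)
    (hk : ContinuousOn k ((Set.Ioo (0 : ℝ) 1 ×ˢ Set.Ioo (0 : ℝ) 1) \ C))
    (hkj : ∀ z ∈ C, ∃ n : ℤ, ∀ᶠ p in nhds z, (0 < φ p → k p = n + 1) ∧ (φ p < 0 → k p = n))
    (hfreq : ∀ z ∈ C, (∃ᶠ p in nhds z, 0 < φ p) ∧ ∃ᶠ p in nhds z, φ p < 0)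
    (hC0 : ∀ z ∈ C, φ z = 0) (hCS : C ⊆ Set.Ioo (0 : ℝ) 1 ×ˢ Set.Ioo (0 : ℝ) 1)
    (hcl : ∀ p ∈ Set.Ioo (0 : ℝ) 1 ×ˢ Set.Ioo (0 : ℝ) 1, p ∈ closure C → p ∈ C)
    (hcon : IsPreconnected C) {s t : ℝ} (hs : 0 < s) (hst : s ≤ t) (ht : t < 1)
    (hbdry : ∀ x ∈ Set.Icc s t, (x, s) ∉ C ∧ (x, t) ∉ C ∧ (s, x) ∉ C ∧ (t, x) ∉ C)
    (hin : (C ∩ (Set.Ioo s t ×ˢ Set.Ioo s t)).Nonempty) :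
    ∃ a b : ℝ, 0 ≤ a ∧ a ≤ b ∧ b ≤ 1 ∧ π ≤ √lam * (b - a) ∧ ∀ y ∈ Set.Icc a b,
      ∀ p : Polynomial ℝ, p ≠ 0 →
        (∀ x ∈ Set.Icc (0 : ℝ) 1, φ (x, y) = sin (π * x) * p.eval (cos (π * x))) →
        2 ≤ cosRootCount p {x | x ∈ Set.Icc s t ∧ (x, y) ∈ C} := by
  set S := Set.Ioo (0 : ℝ) 1 ×ˢ Set.Ioo (0 : ℝ) 1 with hS
  set R := Set.Icc s t ×ˢ Set.Icc s t with hR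
  set R' := Set.Ioo s t ×ˢ Set.Ioo s t with hR'
  have hSo : IsOpen S := isOpen_Ioo.prod isOpen_Ioo
  have hRS : R ⊆ S := fun p hp =>
    ⟨⟨hs.trans_le hp.1.1, hp.1.2.trans_lt ht⟩, ⟨hs.trans_le hp.2.1, hp.2.2.trans_lt ht⟩⟩
  have hRc : IsCompact R := isCompact_Icc.prod isCompact_Icc
  have hCR' : C ∩ R ⊆ R' := by
    rintro ⟨x, y⟩ ⟨hpC, hx, hy⟩
    have h1 := hbdry x hx
    have h2 := hbdry y hy
    refine ⟨⟨hx.1.lt_of_ne ?_, hx.2.lt_of_ne ?_⟩, ⟨hy.1.lt_of_ne ?_, hy.2.lt_of_ne ?_⟩⟩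
    · rintro rfl; exact h2.2.2.1 hpC
    · rintro rfl; exact h2.2.2.2 hpC
    · rintro rfl; exact h1.1 hpC
    · rintro rfl; exact h1.2.1 hpC
  have hCR : C ⊆ R' := by
    have := hcon.subset_or_subset (isOpen_Ioo.prod isOpen_Ioo : IsOpen R') hRc.isClosed.isOpen_compl
      (Set.disjoint_left.2 fun p hp hp' => hp' ⟨Set.Ioo_subset_Icc_self hp.1,
        Set.Ioo_subset_Icc_self hp.2⟩) (fun p hp => by
        by_cases h : p ∈ R
        · exact Or.inl (hCR' ⟨hp, h⟩)
        · exact Or.inr h)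
    rcases this with h | h
    · exact h
    · obtain ⟨p, hp, hp'⟩ := hin
      exact absurd ⟨Set.Ioo_subset_Icc_self hp'.1, Set.Ioo_subset_Icc_self hp'.2⟩ (h hp)
  have hR'R : R' ⊆ R := Set.prod_mono Set.Ioo_subset_Icc_self Set.Ioo_subset_Icc_self
  have hCcl : IsClosed C := by
    refine isClosed_of_closure_subset fun p hp => hcl p (hRS ?_) hp
    exact closure_minimal (hCR.trans hR'R) hRc.isClosed hp
  have hCc : IsCompact C := hRc.of_isClosed_subset hCcl (hCR.trans hR'R)
  have hCne : C.Nonempty := hin.mono Set.inter_subset_left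
  obtain ⟨pa, hpaC, hpa⟩ := hCc.exists_isMinOn hCne continuous_snd.continuousOn
  obtain ⟨pb, hpbC, hpb⟩ := hCc.exists_isMaxOn hCne continuous_snd.continuousOn
  have hka : ∀ u ⊆ S, IsPreconnected u → (∀ p ∈ u, p ∉ C) → ∀ p ∈ u, ∀ q ∈ u, k p = k q :=
    fun u hu huc hun p hp q hq => huc.constant (hk.mono fun x hx => ⟨hu hx, hun x hx⟩) hp hq
  have hss : (s, s) ∈ S := hRS ⟨Set.left_mem_Icc.2 hst, Set.left_mem_Icc.2 hst⟩
  have hsI : s ∈ Set.Ioo (0 : ℝ) 1 := hss.1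
  have htI : t ∈ Set.Ioo (0 : ℝ) 1 := ⟨hs.trans_le hst, ht⟩
  set k₀ := k (s, s) with hk₀
  have hout : ∀ p ∈ S, p ∉ R' → k p = k₀ := by
    have hL : ∀ p ∈ S, p.1 ≤ s → k p = k₀ := by
      intro p hp hps
      refine hka (Set.Ioc 0 s ×ˢ Set.Ioo 0 1) (fun q hq => ⟨⟨hq.1.1, hq.1.2.trans_lt hsI.2⟩, hq.2⟩)
        (isPreconnected_Ioc.prod isPreconnected_Ioo) (fun q hq hqC => ?_) p ⟨⟨hp.1.1, hps⟩, hp.2⟩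
        _ ⟨⟨hs, le_rfl⟩, hsI⟩
      exact absurd (hCR hqC).1.1 hq.1.2.not_gt
    have hB : ∀ p ∈ S, p.2 ≤ s → k p = k₀ := by
      intro p hp hps
      refine hka (Set.Ioo 0 1 ×ˢ Set.Ioc 0 s) (fun q hq => ⟨hq.1, ⟨hq.2.1, hq.2.2.trans_lt hsI.2⟩⟩)
        (isPreconnected_Ioo.prod isPreconnected_Ioc) (fun q hq hqC => ?_) p ⟨hp.1, ⟨hp.2.1, hps⟩⟩
        _ ⟨hsI, ⟨hs, le_rfl⟩⟩
      exact absurd (hCR hqC).2.1 hq.2.2.not_gt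
    have hRt : ∀ p ∈ S, t ≤ p.1 → k p = k₀ := by
      intro p hp hpt
      rw [← hB (t, s) ⟨htI, hsI⟩ le_rfl]
      refine hka (Set.Ico t 1 ×ˢ Set.Ioo 0 1) (fun q hq => ⟨⟨htI.1.trans_le hq.1.1, hq.1.2⟩, hq.2⟩)
        (isPreconnected_Ico.prod isPreconnected_Ioo) (fun q hq hqC => ?_) p ⟨⟨hpt, hp.1.2⟩, hp.2⟩
        _ ⟨⟨le_rfl, ht⟩, hsI⟩
      exact absurd (hCR hqC).1.2 hq.1.1.not_gt
    have hT : ∀ p ∈ S, t ≤ p.2 → k p = k₀ := by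
      intro p hp hpt
      rw [← hL (s, t) ⟨hsI, htI⟩ le_rfl]
      refine hka (Set.Ioo 0 1 ×ˢ Set.Ico t 1) (fun q hq => ⟨hq.1, ⟨htI.1.trans_le hq.2.1, hq.2.2⟩⟩)
        (isPreconnected_Ioo.prod isPreconnected_Ico) (fun q hq hqC => ?_) p ⟨hp.1, ⟨hpt, hp.2.2⟩⟩
        _ ⟨hsI, ⟨le_rfl, ht⟩⟩
      exact absurd (hCR hqC).2.2 hq.2.1.not_gt
    intro p hp hpR
    by_contra hkp
    refine hpR ⟨⟨?_, ?_⟩, ⟨?_, ?_⟩⟩ <;> by_contra! h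
    · exact hkp (hL p hp h)
    · exact hkp (hRt p hp h)
    · exact hkp (hB p hp h)
    · exact hkp (hT p hp h)
  set W := {p | p ∈ S \ C ∧ k p ≠ k₀} with hW
  have hSC : IsOpen (S \ C) := hSo.sdiff hCcl
  have hWo : IsOpen W := hk.isOpen_inter_preimage hSC (isOpen_discrete {n : ℤ | n ≠ k₀})
  have hWo' : IsOpen {p | p ∈ S \ C ∧ k p = k₀} :=
    hk.isOpen_inter_preimage hSC (isOpen_discrete {n : ℤ | n = k₀})
  have hWR : W ⊆ R := fun p hp => hR'R (by
    by_contra h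
    exact hp.2 (hout p hp.1.1 h))
  have hQ : IsCompact (W ∪ C) := by
    have : W ∪ C = R \ {p | p ∈ S \ C ∧ k p = k₀} := by
      ext p
      constructor
      · rintro (h | h)
        · exact ⟨hWR h, fun h' => h.2 h'.2⟩
        · exact ⟨hR'R (hCR h), fun h' => h'.1.2 h⟩
      · rintro ⟨h, h'⟩
        by_cases hpC : p ∈ C
        · exact Or.inr hpC
        · exact Or.inl ⟨⟨hRS h, hpC⟩, fun hkp => h' ⟨⟨hRS h, hpC⟩, hkp⟩⟩
    rw [this]
    exact hRc.diff hWo'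
  have hab : ∀ p ∈ W ∪ C, pa.2 ≤ p.2 ∧ p.2 ≤ pb.2 := by
    have hCab : ∀ p ∈ C, pa.2 ≤ p.2 ∧ p.2 ≤ pb.2 := fun p hp => ⟨hpa hp, hpb hp⟩
    rintro p (hp | hp)
    · by_contra hcon'
      have hline : ∀ q ∈ Set.Ioo (0 : ℝ) 1 ×ˢ {p.2}, q ∉ C := by
        rintro q ⟨-, hq⟩ hqC
        have hq' : q.2 = p.2 := hq
        exact hcon' (hq' ▸ hCab q hqC)
      refine hp.2 ?_
      rw [← hout (s, p.2) ⟨hsI, hp.1.1.2⟩ (fun h => lt_irrefl _ h.1.1)]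
      exact hka _ (fun q hq => ⟨hq.1, by rw [show q.2 = p.2 from hq.2]; exact hp.1.1.2⟩)
        (isPreconnected_Ioo.prod isPreconnected_singleton) hline p ⟨hp.1.1.1, rfl⟩ _ ⟨hsI, rfl⟩
    · exact hCab p hp
  have hWne : ∃ p ∈ W, φ p ≠ 0 := by
    obtain ⟨z, hz⟩ := hCne
    obtain ⟨n, hn⟩ := hkj z hz
    have hSn : ∀ᶠ p in nhds z, p ∈ S := hSo.mem_nhds (hCS hz)
    by_cases hnk : n = k₀
    · obtain ⟨p, hp, h1, h2⟩ := ((hfreq z hz).1.and_eventually (hn.and hSn)).exists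
      refine ⟨p, ⟨⟨h2, fun h => hp.ne' (hC0 p h)⟩, ?_⟩, hp.ne'⟩
      rw [h1.1 hp]; omega
    · obtain ⟨p, hp, h1, h2⟩ := ((hfreq z hz).2.and_eventually (hn.and hSn)).exists
      refine ⟨p, ⟨⟨h2, fun h => hp.ne (hC0 p h)⟩, ?_⟩, hp.ne⟩
      rw [h1.2 hp]; exact hnk
  have hheight := pi_le_sqrt_mul_height hC2 hlam hWo hQ Set.subset_union_left
    (fun p hp hpW => hC0 p (hp.resolve_left hpW)) (fun p hp => heig p hp.1.1) hWne hab
  refine ⟨pa.2, pb.2, (hCS hpaC).2.1.le, hpa hpbC, (hCS hpbC).2.2.le, hheight, ?_⟩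
  intro y hy p hp hpφ
  obtain ⟨q, hqC, hqy⟩ : ∃ q ∈ C, q.2 = y := by
    have := (hcon.image Prod.snd continuous_snd.continuousOn).Icc_subset
      (Set.mem_image_of_mem _ hpaC) (Set.mem_image_of_mem _ hpbC) hy
    exact this
  have hqR := hCR hqC
  have hyI : y ∈ Set.Ioo (0 : ℝ) 1 := hqy ▸ (hCS hqC).2
  have hyst : y ∈ Set.Icc s t := hqy ▸ Set.Ioo_subset_Icc_self hqR.2
  obtain ⟨h0, h1⟩ := jump_of_cosRootCount hk hkj hC0 (γ := fun x => (x, y)) (by fun_prop) hs hst ht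
    (fun x hx => hRS ⟨hx, hyst⟩) hp hpφ
  by_contra! hlt
  have hc : cosRootCount p {x | x ∈ Set.Icc s t ∧ (x, y) ∈ C} = 0 ∨
      cosRootCount p {x | x ∈ Set.Icc s t ∧ (x, y) ∈ C} = 1 := by omega
  rcases hc with hc | hc
  · refine (h0 hc).1 q.1 (Set.Ioo_subset_Icc_self hqR.1) ?_
    rw [← hqy]; exact hqC
  · refine h1 hc (hbdry y hyst).2.2.1 (hbdry y hyst).2.2.2 ?_
    rw [hout (s, y) ⟨hsI, hyI⟩ fun h => lt_irrefl _ h.1.1,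
      hout (t, y) ⟨htI, hyI⟩ fun h => lt_irrefl _ h.1.2]

theorem laplacian2_swap (φ : ℝ × ℝ → ℝ) (p : ℝ × ℝ) :
    laplacian2 (fun q => φ q.swap) p = laplacian2 φ p.swap := by
  simp only [laplacian2, Prod.swap_prod_mk, Prod.fst_swap, Prod.snd_swap]
  rw [add_comm]

theorem swap_mem_frontier_square {p : ℝ × ℝ}
    (hp : p ∈ frontier (Set.Icc (0 : ℝ) 1 ×ˢ Set.Icc (0 : ℝ) 1)) :
    p.swap ∈ frontier (Set.Icc (0 : ℝ) 1 ×ˢ Set.Icc (0 : ℝ) 1) := by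
  have h := (Homeomorph.prodComm ℝ ℝ).preimage_frontier (Set.Icc (0 : ℝ) 1 ×ˢ Set.Icc (0 : ℝ) 1)
  have h2 : (Homeomorph.prodComm ℝ ℝ) ⁻¹' (Set.Icc (0 : ℝ) 1 ×ˢ Set.Icc (0 : ℝ) 1) =
      Set.Icc (0 : ℝ) 1 ×ˢ Set.Icc (0 : ℝ) 1 := by
    ext q
    simp only [Set.mem_preimage, Homeomorph.coe_prodComm, Set.mem_prod, Prod.fst_swap,
      Prod.snd_swap]
    exact and_comm
  rw [h2] at h
  rw [← h] at hp
  exact hp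

theorem fderiv_swap_ne_zero {φ : ℝ × ℝ → ℝ} (hφ : Differentiable ℝ φ) {p : ℝ × ℝ}
    (h : fderiv ℝ φ p.swap ≠ 0) : fderiv ℝ (fun q => φ q.swap) p ≠ 0 := by
  intro h0
  apply h
  have h1 : HasFDerivAt (fun q : ℝ × ℝ => φ q.swap) (0 : ℝ × ℝ →L[ℝ] ℝ) p := by
    rw [← h0]
    exact ((hφ p.swap).comp p (differentiable_snd.prodMk differentiable_fst p)).hasFDerivAt
  have h2 : HasFDerivAt (fun q : ℝ × ℝ => (q.2, q.1))
      ((ContinuousLinearMap.snd ℝ ℝ ℝ).prod (ContinuousLinearMap.fst ℝ ℝ ℝ)) p.swap :=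
    hasFDerivAt_snd.prodMk hasFDerivAt_fst
  have h3 := HasFDerivAt.comp p.swap (g := fun q : ℝ × ℝ => φ q.swap) (g' := 0)
    (by simpa using h1) h2
  rw [ContinuousLinearMap.zero_comp] at h3
  exact h3.fderiv

/-- Only countably many horizontal lines are contained in the zero set. -/
theorem countable_zero_lines {φ : ℝ × ℝ → ℝ} (hφ : Differentiable ℝ φ)
    (hsing : ∀ p ∈ Set.Ioo (0 : ℝ) 1 ×ˢ Set.Ioo (0 : ℝ) 1, φ p = 0 → fderiv ℝ φ p ≠ 0) :
    {y | y ∈ Set.Ioo (0 : ℝ) 1 ∧ ∀ x ∈ Set.Icc (0 : ℝ) 1, φ (x, y) = 0}.Countable := by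
  refine (countable_setOfPred_isolated_right_within (s := {y | y ∈ Set.Ioo (0 : ℝ) 1 ∧
    ∀ x ∈ Set.Icc (0 : ℝ) 1, φ (x, y) = 0})).mono fun y hy => And.intro hy ?_
  have hd : HasFDerivAt φ (fderiv ℝ φ (1 / 2, y)) (1 / 2, y) := (hφ _).hasFDerivAt
  have hI : (1 / 2 : ℝ) ∈ Set.Ioo (0 : ℝ) 1 := by constructor <;> norm_num
  have hne := hsing (1 / 2, y) ⟨hI, hy.1⟩ (hy.2 _ (Set.Ioo_subset_Icc_self hI))
  have hx : HasDerivAt (fun x => φ (x, y)) (fderiv ℝ φ (1 / 2, y) (1, 0)) (1 / 2) :=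
    HasFDerivAt.comp_hasDerivAt (1 / 2) hd ((hasDerivAt_id _).prodMk (hasDerivAt_const _ y))
  have hyd : HasDerivAt (fun y' => φ (1 / 2, y')) (fderiv ℝ φ (1 / 2, y) (0, 1)) y :=
    HasFDerivAt.comp_hasDerivAt y hd ((hasDerivAt_const y (1 / 2)).prodMk (hasDerivAt_id y))
  have hx0 : fderiv ℝ φ (1 / 2, y) (1, 0) = 0 := by
    have : (fun x => φ (x, y)) =ᶠ[nhds (1 / 2)] fun _ => 0 := by
      filter_upwards [isOpen_Ioo.mem_nhds hI] with x hx
      exact hy.2 x (Set.Ioo_subset_Icc_self hx)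
    rw [← hx.deriv, this.deriv_eq, deriv_const]
  have hy0 : fderiv ℝ φ (1 / 2, y) (0, 1) ≠ 0 := by
    intro h
    apply hne
    ext
    · simpa using hx0
    · simpa using h
  have hev := hyd.eventually_ne (c := 0) hy0
  rw [← Filter.eventually_false_iff_eq_bot]
  rw [eventually_nhdsWithin_iff] at hev ⊢
  filter_upwards [hev] with z hz hz'
  exact hz (ne_of_gt hz'.2) (hz'.1.2 _ (Set.Ioo_subset_Icc_self hI))

/-- If the intervals `[a i, b i]` cover almost every point at most `M / 2` times, their total
length is at most `M / 2`. -/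
theorem sum_lengths_le {ι : Type*} (T : Finset ι) {a b : ι → ℝ} {M : ℝ} {B : Set ℝ}
    (hB : B.Countable) (hab : ∀ i ∈ T, 0 ≤ a i ∧ a i ≤ b i ∧ b i ≤ 1)
    (h : ∀ y ∈ Set.Icc (0 : ℝ) 1, y ∉ B →
      ∑ i ∈ T, (Set.Icc (a i) (b i)).indicator (fun _ => (2 : ℝ)) y ≤ M) :
    ∑ i ∈ T, 2 * (b i - a i) ≤ M := by
  have hint : ∀ i ∈ T, MeasureTheory.Integrable
      ((Set.Icc (a i) (b i)).indicator fun _ => (2 : ℝ)) := fun i _ =>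
    (MeasureTheory.integrable_indicator_iff measurableSet_Icc).2
      (MeasureTheory.integrableOn_const (by simp))
  have h1 : ∫ y, ∑ i ∈ T, (Set.Icc (a i) (b i)).indicator (fun _ => (2 : ℝ)) y =
      ∑ i ∈ T, 2 * (b i - a i) := by
    rw [MeasureTheory.integral_finsetSum _ hint]
    refine Finset.sum_congr rfl fun i hi => ?_
    rw [MeasureTheory.integral_indicator_const _ measurableSet_Icc,
      Real.volume_real_Icc_of_le (hab i hi).2.1, smul_eq_mul, mul_comm]
  have h2 : ∫ y, (Set.Icc (0 : ℝ) 1).indicator (fun _ => M) y = M := by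
    rw [MeasureTheory.integral_indicator_const _ measurableSet_Icc,
      Real.volume_real_Icc_of_le zero_le_one]
    simp
  rw [← h1, ← h2]
  refine MeasureTheory.integral_mono_ae (MeasureTheory.integrable_finsetSum _ hint)
    ((MeasureTheory.integrable_indicator_iff measurableSet_Icc).2
      (MeasureTheory.integrableOn_const (by simp))) ?_
  filter_upwards [hB.ae_notMem MeasureTheory.volume] with y hy
  by_cases hyI : y ∈ Set.Icc (0 : ℝ) 1
  · rw [Set.indicator_of_mem hyI]
    exact h y hyI hy
  · rw [Set.indicator_of_notMem hyI]
    refine (Finset.sum_eq_zero fun i hi => Set.indicator_of_notMem (fun hyi => hyI ?_) _).le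
    exact ⟨(hab i hi).1.trans hyi.1, hyi.2.trans (hab i hi).2.2⟩

/-- Basic properties of the components of the zero set of a function all of whose zeros in `S` are
regular. -/
theorem zero_component_properties {S : Set (ℝ × ℝ)} {φ : ℝ × ℝ → ℝ} (hS : IsOpen S)
    (hφ : Continuous φ)
    (hloc : ∀ z ∈ S, φ z = 0 → ∀ N ∈ nhds z, ∃ U ⊆ N, IsOpen U ∧ z ∈ U ∧
      IsPreconnected (U ∩ {p | φ p = 0}) ∧ IsPreconnected (U ∩ {p | 0 < φ p}) ∧
      IsPreconnected (U ∩ {p | φ p < 0}) ∧ (U ∩ {p | 0 < φ p}).Nonempty ∧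
      (U ∩ {p | φ p < 0}).Nonempty) {w : ℝ × ℝ} {C : Set (ℝ × ℝ)}
    (hC : connectedComponentIn {p | p ∈ S ∧ φ p = 0} w = C) :
    (∀ p ∈ S, p ∈ closure C → p ∈ C) ∧
    ∀ p ∈ S, p ∈ closure ({p | p ∈ S ∧ φ p = 0} \ C) → p ∈ {p | p ∈ S ∧ φ p = 0} \ C := by
  set Z := {p | p ∈ S ∧ φ p = 0} with hZ
  have hCZ : C ⊆ Z := hC ▸ connectedComponentIn_subset _ _
  have hnear : ∀ z ∈ Z, ∀ᶠ p in nhds z, p ∈ Z →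
      connectedComponentIn Z p = connectedComponentIn Z z := by
    intro z hz
    obtain ⟨U, hUS, hUo, hzU, hpre, -⟩ := hloc z hz.1 hz.2 S (hS.mem_nhds hz.1)
    filter_upwards [hUo.mem_nhds hzU] with p hp hpZ
    exact (connectedComponentIn_eq (hpre.subset_connectedComponentIn ⟨hzU, hz.2⟩
      (fun q hq => ⟨hUS hq.1, hq.2⟩ : _ ⊆ Z) ⟨hp, hpZ.2⟩)).symm
  have hcomp : ∀ p ∈ Z, p ∈ C ↔ connectedComponentIn Z p = C := by
    intro p hp
    constructor
    · intro h
      rw [← hC] at h ⊢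
      exact (connectedComponentIn_eq h).symm
    · intro h
      rw [← h]
      exact mem_connectedComponentIn hp
  have hcl : ∀ p, p ∈ closure Z → φ p = 0 := fun p hp =>
    closure_minimal (fun q hq => hq.2) (isClosed_eq hφ continuous_const) hp
  constructor
  · intro p hp hpc
    have hpZ : p ∈ Z := ⟨hp, hcl p (closure_mono hCZ hpc)⟩
    obtain ⟨q, hq, h⟩ := ((mem_closure_iff_frequently.1 hpc).and_eventually (hnear p hpZ)).exists
    rw [hcomp p hpZ, ← h (hCZ hq), ← hcomp q (hCZ hq)]
    exact hq
  · intro p hp hpc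
    have hpZ : p ∈ Z := ⟨hp, hcl p (closure_mono Set.sdiff_subset hpc)⟩
    refine ⟨hpZ, fun hpC => ?_⟩
    obtain ⟨q, hq, h⟩ := ((mem_closure_iff_frequently.1 hpc).and_eventually (hnear p hpZ)).exists
    refine hq.2 ?_
    rw [hcomp q hq.1, h hq.1, ← hcomp p hpZ]
    exact hpC

theorem card_zero_components_le {φ : ℝ × ℝ → ℝ} {lam : ℝ} (hlam : 0 < lam)
    (hC2 : ContDiff ℝ 2 φ)
    (heig : ∀ p ∈ Set.Icc (0 : ℝ) 1 ×ˢ Set.Icc (0 : ℝ) 1, laplacian2 φ p = -lam * φ p)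
    (hbd : ∀ p ∈ frontier (Set.Icc (0 : ℝ) 1 ×ˢ Set.Icc (0 : ℝ) 1), φ p = 0)
    (hsing : ∀ p ∈ Set.Ioo (0 : ℝ) 1 ×ˢ Set.Ioo (0 : ℝ) 1, φ p = 0 → fderiv ℝ φ p ≠ 0)
    (hloc : ∀ z ∈ Set.Ioo (0 : ℝ) 1 ×ˢ Set.Ioo (0 : ℝ) 1, φ z = 0 → ∀ N ∈ nhds z,
      ∃ U ⊆ N, IsOpen U ∧ z ∈ U ∧
      IsPreconnected (U ∩ {p | φ p = 0}) ∧ IsPreconnected (U ∩ {p | 0 < φ p}) ∧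
      IsPreconnected (U ∩ {p | φ p < 0}) ∧ (U ∩ {p | 0 < φ p}).Nonempty ∧
      (U ∩ {p | φ p < 0}).Nonempty)
    (T : Finset (Set (ℝ × ℝ)))
    (hT : ∀ C ∈ T, ∃ z ∈ {p | p ∈ Set.Ioo (0 : ℝ) 1 ×ˢ Set.Ioo (0 : ℝ) 1 ∧ φ p = 0},
      connectedComponentIn {p | p ∈ Set.Ioo (0 : ℝ) 1 ×ˢ Set.Ioo (0 : ℝ) 1 ∧ φ p = 0} z = C) :
    (T.card : ℝ) ≤ lam / (2 * π ^ 2) + 2 * √lam / π := by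
  classical
  set S := Set.Ioo (0 : ℝ) 1 ×ˢ Set.Ioo (0 : ℝ) 1 with hS
  set Z := {p | p ∈ S ∧ φ p = 0} with hZ
  have hSo : IsOpen S := isOpen_Ioo.prod isOpen_Ioo
  have hSconv : Convex ℝ S := (convex_Ioo 0 1).prod (convex_Ioo 0 1)
  have hSne : Sᶜ.Nonempty := ⟨(0, 0), fun h => lt_irrefl _ h.1.1⟩
  have hφ := hC2.continuous
  have hdiff : Differentiable ℝ φ := hC2.differentiable two_ne_zero
  choose! z hzZ hz using hT
  have hCZ : ∀ C ∈ T, C ⊆ Z := fun C hC => hz C hC ▸ connectedComponentIn_subset _ _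
  have hzC : ∀ C ∈ T, z C ∈ C := fun C hC => by
    have := mem_connectedComponentIn (hzZ C hC)
    rwa [hz C hC] at this
  have hdisj : ∀ C ∈ T, ∀ D ∈ T, C ≠ D → Disjoint C D := by
    intro C hC D hD hCD
    refine Set.disjoint_left.2 fun p hpC hpD => hCD ?_
    rw [← hz C hC] at hpC ⊢
    rw [← hz D hD] at hpD ⊢
    exact (connectedComponentIn_eq hpC).trans (connectedComponentIn_eq hpD).symm
  have hk : ∀ C ∈ T, ∃ k : ℝ × ℝ → ℤ, ContinuousOn k (S \ C) ∧ ∀ z ∈ C, ∃ n : ℤ,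
      ∀ᶠ p in nhds z, (0 < φ p → k p = n + 1) ∧ (φ p < 0 → k p = n) := by
    intro C hC
    obtain ⟨h1, h2⟩ := zero_component_properties hSo hφ hloc (hz C hC)
    exact exists_jump_function hφ hSne hSo hSconv h1 h2 ⟨_, hzC C hC⟩ Set.disjoint_sdiff_right
      ((hCZ C hC).trans fun p hp => hp.1) (fun p hp => (hCZ C hC hp).2)
      fun p hp h0 => or_iff_not_imp_left.2 fun hpC => ⟨⟨hp, h0⟩, hpC⟩
  choose! k hkc hkj using hk
  choose! P hPdeg hP using exists_polynomial_slice hC2 heig hbd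
  choose! Q hQdeg hQ using exists_polynomial_slice (φ := fun q : ℝ × ℝ => φ q.swap)
    (hC2.comp (contDiff_snd.prodMk contDiff_fst))
    (fun p hp => by rw [laplacian2_swap]; exact heig _ ⟨hp.2, hp.1⟩)
    (fun p hp => hbd _ (swap_mem_frontier_square hp))
  have hBh := countable_zero_lines hdiff hsing
  have hBv := countable_zero_lines (φ := fun q : ℝ × ℝ => φ q.swap)
    (hdiff.comp (differentiable_snd.prodMk differentiable_fst))
    (fun p hp h0 => fderiv_swap_ne_zero hdiff (hsing _ ⟨hp.2, hp.1⟩ h0))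
  set Bh := {y | y ∈ Set.Ioo (0 : ℝ) 1 ∧ ∀ x ∈ Set.Icc (0 : ℝ) 1, φ (x, y) = 0} with hBhd
  set Bv := {y | y ∈ Set.Ioo (0 : ℝ) 1 ∧ ∀ x ∈ Set.Icc (0 : ℝ) 1, φ (y, x) = 0} with hBvd
  have hPne : ∀ y ∈ Set.Ioo (0 : ℝ) 1, y ∉ Bh → P y ≠ 0 := by
    intro y hy hyB h
    refine hyB ⟨hy, fun x hx => ?_⟩
    rw [hP y (Set.Ioo_subset_Icc_self hy) x hx, h]; simp
  have hQne : ∀ y ∈ Set.Ioo (0 : ℝ) 1, y ∉ Bv → Q y ≠ 0 := by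
    intro y hy hyB h
    refine hyB ⟨hy, fun x hx => ?_⟩
    have := hQ y (Set.Ioo_subset_Icc_self hy) x hx
    rw [h] at this
    simpa using this
  obtain ⟨s, hs, hs2, hzs, hsh, hsv, hth, htv⟩ : ∃ s : ℝ, 0 < s ∧ s < 1 / 2 ∧
      (∀ C ∈ T, z C ∈ Set.Ioo s (1 - s) ×ˢ Set.Ioo s (1 - s)) ∧ s ∉ Bh ∧ s ∉ Bv ∧
      1 - s ∉ Bh ∧ 1 - s ∉ Bv := by
    have hev : ∀ᶠ s in nhds (0 : ℝ), s < 1 / 2 ∧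
        ∀ C ∈ T, z C ∈ Set.Ioo s (1 - s) ×ˢ Set.Ioo s (1 - s) := by
      refine (eventually_lt_nhds (by norm_num)).and ((Filter.eventually_all_finset T).2 fun C hC => ?_)
      have hzS := (hzZ C hC).1
      have h1 : ∀ᶠ s in nhds (0 : ℝ), s < (z C).1 := eventually_lt_nhds hzS.1.1
      have h2 : ∀ᶠ s in nhds (0 : ℝ), s < (z C).2 := eventually_lt_nhds hzS.2.1
      have h3 : ∀ᶠ s in nhds (0 : ℝ), s < 1 - (z C).1 := eventually_lt_nhds (by linarith [hzS.1.2])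
      have h4 : ∀ᶠ s in nhds (0 : ℝ), s < 1 - (z C).2 := eventually_lt_nhds (by linarith [hzS.2.2])
      filter_upwards [h1, h2, h3, h4] with s h1 h2 h3 h4
      exact ⟨⟨h1, by linarith⟩, ⟨h2, by linarith⟩⟩
    obtain ⟨δ, hδ, hball⟩ := Metric.eventually_nhds_iff.1 hev
    have hinj : Function.Injective fun s : ℝ => 1 - s := fun a b h => by
      simp only at h; linarith
    have hcount : (Bh ∪ Bv ∪ (fun s : ℝ => 1 - s) ⁻¹' (Bh ∪ Bv)).Countable :=
      (hBh.union hBv).union ((hBh.union hBv).preimage hinj)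
    obtain ⟨s, hsB, hsI⟩ := (hcount.dense_compl ℝ).exists_mem_open isOpen_Ioo
      (Set.nonempty_Ioo.2 hδ)
    have := hball (y := s) (by rw [Real.dist_eq, sub_zero, abs_of_pos hsI.1]; exact hsI.2)
    exact ⟨s, hsI.1, this.1, this.2, fun h => hsB (Or.inl (Or.inl h)),
      fun h => hsB (Or.inl (Or.inr h)), fun h => hsB (Or.inr (Or.inl h)),
      fun h => hsB (Or.inr (Or.inr h))⟩
  set t := 1 - s with htd
  have hst : s ≤ t := by linarith
  have ht : t < 1 := by linarith
  have hsI : s ∈ Set.Ioo (0 : ℝ) 1 := ⟨hs, by linarith⟩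
  have htI : t ∈ Set.Ioo (0 : ℝ) 1 := ⟨by linarith, ht⟩
  have hsI' := Set.Ioo_subset_Icc_self hsI
  have htI' := Set.Ioo_subset_Icc_self htI
  set M := √lam / π with hM
  set avoid : Set (ℝ × ℝ) → Prop := fun C =>
    ∀ x ∈ Set.Icc s t, (x, s) ∉ C ∧ (x, t) ∉ C ∧ (s, x) ∉ C ∧ (t, x) ∉ C with havoid
  have hsum : ∀ T' ⊆ T, ∀ γ : ℝ → ℝ × ℝ, ∀ p : Polynomial ℝ,
      ∑ C ∈ T', cosRootCount p {x | x ∈ Set.Icc s t ∧ γ x ∈ C} ≤ p.natDegree := by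
    intro T' hT' γ p
    refine sum_cosRootCount_le T' _ (fun C hC D hD hCD => ?_) p
    exact Set.disjoint_left.2 fun x hx hx' =>
      Set.disjoint_left.1 (hdisj C (hT' hC) D (hT' hD) hCD) hx.2 hx'.2
  have hcross : 2 * ((T.filter fun C => ¬ avoid C).card : ℝ) ≤ 4 * M := by
    have h1 : ∑ C ∈ T.filter (fun C => ¬ avoid C), 2 ≤
        ∑ C ∈ T.filter (fun C => ¬ avoid C),
          (cosRootCount (P s) {x | x ∈ Set.Icc s t ∧ (x, s) ∈ C} +
            cosRootCount (P t) {x | x ∈ Set.Icc s t ∧ (x, t) ∈ C} +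
            cosRootCount (Q s) {x | x ∈ Set.Icc s t ∧ (s, x) ∈ C} +
            cosRootCount (Q t) {x | x ∈ Set.Icc s t ∧ (t, x) ∈ C}) := by
      refine Finset.sum_le_sum fun C hC => ?_
      rw [Finset.mem_filter] at hC
      exact (two_le_boundary_count (hkc C hC.1) (hkj C hC.1) (fun p hp => (hCZ C hC.1 hp).2) hs hst
        ht (hPne s hsI hsh) (hPne t htI hth) (hQne s hsI hsv) (hQne t htI htv) (hP s hsI')
        (hP t htI') (hQ s hsI') (hQ t htI')).resolve_right hC.2
    rw [Finset.sum_add_distrib, Finset.sum_add_distrib, Finset.sum_add_distrib, Finset.sum_const,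
      smul_eq_mul] at h1
    have h2 := hsum _ (Finset.filter_subset (fun C => ¬ avoid C) T) (fun x => (x, s)) (P s)
    have h3 := hsum _ (Finset.filter_subset (fun C => ¬ avoid C) T) (fun x => (x, t)) (P t)
    have h4 := hsum _ (Finset.filter_subset (fun C => ¬ avoid C) T) (fun x => (s, x)) (Q s)
    have h5 := hsum _ (Finset.filter_subset (fun C => ¬ avoid C) T) (fun x => (t, x)) (Q t)
    have h6 : (T.filter fun C => ¬ avoid C).card * 2 ≤ (P s).natDegree + (P t).natDegree +
        (Q s).natDegree + (Q t).natDegree := by omega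
    have h7 : ((T.filter fun C => ¬ avoid C).card : ℝ) * 2 ≤ (P s).natDegree + (P t).natDegree +
        (Q s).natDegree + (Q t).natDegree := by exact_mod_cast h6
    linarith [hPdeg s hsI', hPdeg t htI', hQdeg s hsI', hQdeg t htI']
  have hinside : ∀ C ∈ T.filter avoid, ∃ a b : ℝ, 0 ≤ a ∧ a ≤ b ∧ b ≤ 1 ∧ π ≤ √lam * (b - a) ∧
      ∀ y ∈ Set.Icc a b, ∀ p : Polynomial ℝ, p ≠ 0 →
        (∀ x ∈ Set.Icc (0 : ℝ) 1, φ (x, y) = sin (π * x) * p.eval (cos (π * x))) →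
        2 ≤ cosRootCount p {x | x ∈ Set.Icc s t ∧ (x, y) ∈ C} := by
    intro C hC
    rw [Finset.mem_filter] at hC
    refine exists_height_interval hlam hC2 (fun p hp => heig p
      ⟨Set.Ioo_subset_Icc_self hp.1, Set.Ioo_subset_Icc_self hp.2⟩) (hkc C hC.1) (hkj C hC.1) ?_
      (fun p hp => (hCZ C hC.1 hp).2) ((hCZ C hC.1).trans fun p hp => hp.1)
      (zero_component_properties hSo hφ hloc (hz C hC.1)).1
      (hz C hC.1 ▸ isPreconnected_connectedComponentIn) hs hst ht hC.2 ⟨_, hzC C hC.1, hzs C hC.1⟩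
    intro w hw
    have hwZ := hCZ C hC.1 hw
    constructor
    · rw [Filter.frequently_iff]
      intro A hA
      obtain ⟨U, hUA, -, -, -, -, -, ⟨a, ha⟩, -⟩ := hloc w hwZ.1 hwZ.2 A hA
      exact ⟨a, hUA ha.1, ha.2⟩
    · rw [Filter.frequently_iff]
      intro A hA
      obtain ⟨U, hUA, -, -, -, -, -, -, ⟨a, ha⟩⟩ := hloc w hwZ.1 hwZ.2 A hA
      exact ⟨a, hUA ha.1, ha.2⟩
  choose! a b ha hab hb hheight hcount using hinside
  have hlen : ∑ C ∈ T.filter avoid, 2 * (b C - a C) ≤ M := by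
    refine sum_lengths_le (T.filter avoid) (B := Bh ∪ {0, 1})
      (hBh.union (Set.toFinite {0, 1}).countable) (fun C hC => ⟨ha C hC, hab C hC, hb C hC⟩) ?_
    intro y hy hyB
    have hyI : y ∈ Set.Ioo (0 : ℝ) 1 :=
      ⟨hy.1.lt_of_ne (by rintro rfl; exact hyB (Or.inr (Or.inl rfl))),
        hy.2.lt_of_ne (by rintro rfl; exact hyB (Or.inr (Or.inr rfl)))⟩
    have hPy := hPne y hyI fun h => hyB (Or.inl h)
    calc ∑ C ∈ T.filter avoid, (Set.Icc (a C) (b C)).indicator (fun _ => (2 : ℝ)) y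
        ≤ ∑ C ∈ T.filter avoid,
          (cosRootCount (P y) {x | x ∈ Set.Icc s t ∧ (x, y) ∈ C} : ℝ) := by
          refine Finset.sum_le_sum fun C hC => ?_
          by_cases hyC : y ∈ Set.Icc (a C) (b C)
          · rw [Set.indicator_of_mem hyC]
            exact_mod_cast hcount C hC y hyC (P y) hPy (hP y hy)
          · rw [Set.indicator_of_notMem hyC]
            positivity
      _ ≤ (P y).natDegree := by
          exact_mod_cast hsum _ (Finset.filter_subset avoid T) (fun x => (x, y)) (P y)
      _ ≤ M := hPdeg y hy
  have hsl : 0 < √lam := Real.sqrt_pos.2 hlam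
  have hin : ((T.filter avoid).card : ℝ) * (2 * π) ≤ √lam * M := by
    have h1 : ∑ C ∈ T.filter avoid, (2 * π) ≤ √lam * ∑ C ∈ T.filter avoid, 2 * (b C - a C) := by
      rw [Finset.mul_sum]
      refine Finset.sum_le_sum fun C hC => ?_
      linarith [hheight C hC]
    rw [Finset.sum_const, nsmul_eq_mul] at h1
    exact h1.trans (mul_le_mul_of_nonneg_left hlen hsl.le)
  have hcard : (T.card : ℝ) =
      (T.filter avoid).card + (T.filter fun C => ¬ avoid C).card := by
    exact_mod_cast (Finset.card_filter_add_card_filter_not avoid).symm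
  have h1 : ((T.filter avoid).card : ℝ) ≤ lam / (2 * π ^ 2) := by
    rw [le_div_iff₀ (by positivity)]
    have : √lam * M * π = lam := by
      rw [hM]; field_simp; exact Real.sq_sqrt hlam.le
    nlinarith [pi_pos]
  have h2 : 2 * √lam / π = 2 * M := by rw [hM]; ring
  rw [hcard, h2]
  linarith

/-- a Dirichlet eigenfunction on the unit square with eigenvalue `λ`
and no interior singular point has at most `λ/(2π²) + 2√λ/π + 1` nodal domains. -/
theorem nodal_domain_bound_square
    (φ : ℝ × ℝ → ℝ) (lam : ℝ) (hlam : 0 < lam)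
    (hC2 : ContDiff ℝ 2 φ)
    (heig : ∀ p ∈ Set.Icc (0 : ℝ) 1 ×ˢ Set.Icc (0 : ℝ) 1, laplacian2 φ p = -lam * φ p)
    (hbd : ∀ p ∈ frontier (Set.Icc (0 : ℝ) 1 ×ˢ Set.Icc (0 : ℝ) 1), φ p = 0)
    (hne : ∃ p ∈ Set.Icc (0 : ℝ) 1 ×ˢ Set.Icc (0 : ℝ) 1, φ p ≠ 0)
    (hsing : ∀ p ∈ Set.Ioo (0 : ℝ) 1 ×ˢ Set.Ioo (0 : ℝ) 1, φ p = 0 → fderiv ℝ φ p ≠ 0) :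
    (({C : Set (ℝ × ℝ) | ∃ p ∈ {q : ℝ × ℝ | q ∈ Set.Ioo (0 : ℝ) 1 ×ˢ Set.Ioo (0 : ℝ) 1 ∧ φ q ≠ 0},
        connectedComponentIn {q : ℝ × ℝ | q ∈ Set.Ioo (0 : ℝ) 1 ×ˢ Set.Ioo (0 : ℝ) 1 ∧ φ q ≠ 0} p = C}).Finite) ∧
    (({C : Set (ℝ × ℝ) | ∃ p ∈ {q : ℝ × ℝ | q ∈ Set.Ioo (0 : ℝ) 1 ×ˢ Set.Ioo (0 : ℝ) 1 ∧ φ q ≠ 0},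
        connectedComponentIn {q : ℝ × ℝ | q ∈ Set.Ioo (0 : ℝ) 1 ×ˢ Set.Ioo (0 : ℝ) 1 ∧ φ q ≠ 0} p = C}).ncard : ℝ)
      ≤ lam / (2 * π ^ 2) + 2 * Real.sqrt lam / π + 1 := by
  have hS : IsOpen (Set.Ioo (0 : ℝ) 1 ×ˢ Set.Ioo (0 : ℝ) 1) := isOpen_Ioo.prod isOpen_Ioo
  have hSc : IsPreconnected (Set.Ioo (0 : ℝ) 1 ×ˢ Set.Ioo (0 : ℝ) 1) :=
    isPreconnected_Ioo.prod isPreconnected_Ioo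
  have hloc : ∀ z ∈ Set.Ioo (0 : ℝ) 1 ×ˢ Set.Ioo (0 : ℝ) 1, φ z = 0 → ∀ N ∈ nhds z,
      ∃ U ⊆ N, IsOpen U ∧ z ∈ U ∧
      IsPreconnected (U ∩ {p | φ p = 0}) ∧ IsPreconnected (U ∩ {p | 0 < φ p}) ∧
      IsPreconnected (U ∩ {p | φ p < 0}) ∧ (U ∩ {p | 0 < φ p}).Nonempty ∧
      (U ∩ {p | φ p < 0}).Nonempty := fun z hz h0 N hN =>
    exists_isOpen_isPreconnected_sign (hC2.contDiffAt.hasStrictFDerivAt two_ne_zero) h0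
      (hsing z hz h0) hN
  have hne' : ∃ p ∈ Set.Ioo (0 : ℝ) 1 ×ˢ Set.Ioo (0 : ℝ) 1, φ p ≠ 0 := by
    obtain ⟨p, hp, hp0⟩ := hne
    refine ⟨p, ?_, hp0⟩
    have h1 : p ∈ interior (Set.Icc (0 : ℝ) 1 ×ˢ Set.Icc (0 : ℝ) 1) := by
      by_contra h
      exact hp0 (hbd p ⟨subset_closure hp, h⟩)
    rwa [interior_prod_eq, interior_Icc] at h1
  set E := {C : Set (ℝ × ℝ) | ∃ z ∈ {p | p ∈ Set.Ioo (0 : ℝ) 1 ×ˢ Set.Ioo (0 : ℝ) 1 ∧ φ p = 0},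
    connectedComponentIn {p | p ∈ Set.Ioo (0 : ℝ) 1 ×ˢ Set.Ioo (0 : ℝ) 1 ∧ φ p = 0} z = C} with hE
  have hcard : ∀ T : Finset (Set (ℝ × ℝ)), (T : Set (Set (ℝ × ℝ))) ⊆ E →
      (T.card : ℝ) ≤ lam / (2 * π ^ 2) + 2 * √lam / π := fun T hT =>
    card_zero_components_le hlam hC2 heig hbd hsing hloc T fun C hC => hT hC
  have hfin : E.Finite := by
    by_contra hinf
    obtain ⟨n, hn⟩ := exists_nat_gt (lam / (2 * π ^ 2) + 2 * √lam / π)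
    obtain ⟨T, hTE, hTn⟩ := Set.Infinite.exists_subset_card_eq hinf n
    have := hcard T hTE
    rw [hTn] at this
    linarith
  obtain ⟨h1, h2⟩ := nodal_domains_finite_and_ncard_le hS hSc hC2.continuous hloc hne' hfin
  refine ⟨h1, ?_⟩
  have h3 := hcard hfin.toFinset (by simp)
  rw [← Set.ncard_eq_toFinset_card E hfin] at h3
  have h4 : (_ : ℝ) ≤ _ := Nat.cast_le.2 h2
  push_cast at h4
  exact h4.trans (by linarith)
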